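/- arXiv:0812.1032 — 2 statements merged into one kernel-verified Lean document; each statement's English description precedes it below -/
import Mathlib

section
/- Let P ⊂ ℝ^n be the interior of an n-dimensional convex polytope. Then the Hilbert geometry (P, d_P) is bi-Lipschitz equivalent to the n-dimensional Euclidean space: there exist a map F : P → ℝ^n and a constant L ≥ 1 such that for all x, y ∈ P one has (1/L)·‖F(x) − F(y)‖ ≤ d_P(x, y) ≤ L·‖F(x) − F(y)‖, where ‖·‖ is the Euclidean norm. -/
open Classical

/-- The Hilbert distance of a convex domain `C`: for `p ≠ q`, the line through `p` and `q`
meets `∂C` at `a = p + t⁻ • (q - p)` and `b = p + t⁺ • (q - p)` where `t⁻ = sInf` and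
`t⁺ = sSup` of the chord parameter set, so that the cross-ratio
`[a,p,q,b] = (‖q-a‖/‖p-a‖)·(‖p-b‖/‖q-b‖)` equals `((1-t⁻)/(-t⁻))·(t⁺/(t⁺-1))`. -/
noncomputable def hilbertDist {E : Type*} [NormedAddCommGroup E] [NormedSpace ℝ E]
    (C : Set E) (p q : E) : ℝ :=
  if p = q then 0
  else ((1 : ℝ) / 2) * Real.log
    (((1 - sInf {t : ℝ | p + t • (q - p) ∈ C}) / (-sInf {t : ℝ | p + t • (q - p) ∈ C})) *
      (sSup {t : ℝ | p + t • (q - p) ∈ C} / (sSup {t : ℝ | p + t • (q - p) ∈ C} - 1)))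

open scoped InnerProductSpace

/-- One-variable Fourier–Motzkin elimination. -/
lemma fm_one {ι : Type*} (S : Finset ι) (α β : ι → ℝ)
    (h1 : ∀ i ∈ S, 0 ≤ α i → 0 ≤ β i)
    (h2 : ∀ i ∈ S, ∀ j ∈ S, 0 ≤ α i → α j < 0 → 0 ≤ α i * β j - α j * β i) :
    ∃ t : ℝ, 0 ≤ t ∧ ∀ i ∈ S, 0 ≤ β i - t * α i := by
  -- choose `t` the largest lower bound
  by_cases hN : (S.filter (fun j => α j < 0)).Nonempty
  · obtain ⟨j, hj, hmax⟩ := Finset.exists_max_image _ (fun j => β j / α j) hN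
    rw [Finset.mem_filter] at hj
    refine ⟨max 0 (β j / α j), le_max_left _ _, fun i hi => ?_⟩
    rcases lt_or_ge (α i) 0 with hi0 | hi0
    · have := hmax i (by simp [hi, hi0])
      have h3 : β i / α i ≤ max 0 (β j / α j) := this.trans (le_max_right _ _)
      rw [div_le_iff_of_neg hi0] at h3
      linarith
    · rcases max_cases 0 (β j / α j) with ⟨h, _⟩ | ⟨h, _⟩
      · rw [h]; have := h1 i hi hi0; linarith
      · rw [h]
        have h4 := h2 i hi j hj.1 hi0 hj.2
        have h5 : β i - β j / α j * α i = (α i * β j - α j * β i) / (- α j) := by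
          have := hj.2.ne
          field_simp
          ring
        rw [h5]
        exact div_nonneg h4 (by linarith [hj.2])
  · refine ⟨0, le_rfl, fun i hi => ?_⟩
    have : 0 ≤ α i := by
      by_contra hc
      exact hN ⟨i, by simp [hi]; linarith⟩
    have := h1 i hi this
    linarith

lemma cone_hrep {n : ℕ} (V : Finset (EuclideanSpace ℝ (Fin n))) :
    ∃ S : Finset (EuclideanSpace ℝ (Fin n) × ℝ), ∀ (x : EuclideanSpace ℝ (Fin n)) (s : ℝ),
      (∃ w : EuclideanSpace ℝ (Fin n) → ℝ, (∀ v ∈ V, 0 ≤ w v) ∧ ∑ v ∈ V, w v = s ∧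
        ∑ v ∈ V, w v • v = x) ↔ ∀ f ∈ S, 0 ≤ ⟪f.1, x⟫_ℝ + f.2 * s := by
  induction V using Finset.induction_on with
  | empty =>
    refine ⟨{(0, 1), (0, -1)} ∪ ((Finset.univ : Finset (Fin n)).image
      (fun i => (EuclideanSpace.single i (1 : ℝ), (0 : ℝ)))) ∪
      ((Finset.univ : Finset (Fin n)).image
      (fun i => (- EuclideanSpace.single i (1 : ℝ), (0 : ℝ)))), fun x s => ?_⟩
    constructor
    · rintro ⟨w, -, hs, hx⟩
      simp only [Finset.sum_empty] at hs hx
      subst hs; subst hx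
      simp
    · intro h
      have a1 := h (0, 1) (by simp)
      have a2 := h (0, -1) (by simp)
      simp at a1 a2
      refine ⟨0, by simp, by simpa using le_antisymm a1 a2, ?_⟩
      simp only [Finset.sum_empty]
      symm
      ext i
      have b1 := h (EuclideanSpace.single i (1 : ℝ), 0) (by simp)
      have b2 := h (-EuclideanSpace.single i (1 : ℝ), 0) (by simp)
      simp [EuclideanSpace.inner_single_left] at b1 b2
      simpa using le_antisymm b2 b1
  | insert a V ha ih =>
    obtain ⟨S, hS⟩ := ih
    let α : EuclideanSpace ℝ (Fin n) × ℝ → ℝ := fun f => ⟪f.1, a⟫_ℝ + f.2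
    refine ⟨S.filter (fun f => 0 ≤ α f) ∪ (((S.filter (fun f => 0 ≤ α f)) ×ˢ
      (S.filter (fun f => α f < 0))).image (fun p => α p.1 • p.2 - α p.2 • p.1)), fun x s => ?_⟩
    have key : (∃ w : EuclideanSpace ℝ (Fin n) → ℝ, (∀ v ∈ insert a V, 0 ≤ w v) ∧
        ∑ v ∈ insert a V, w v = s ∧ ∑ v ∈ insert a V, w v • v = x) ↔
        ∃ t : ℝ, 0 ≤ t ∧ ∀ f ∈ S, 0 ≤ (⟪f.1, x⟫_ℝ + f.2 * s) - t * α f := by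
      have e : ∀ (t : ℝ) (f : EuclideanSpace ℝ (Fin n) × ℝ),
          (⟪f.1, x⟫_ℝ + f.2 * s) - t * α f = ⟪f.1, x - t • a⟫_ℝ + f.2 * (s - t) := by
        intro t f
        simp only [α, inner_sub_right, inner_smul_right]
        ring
      simp_rw [e, ← hS]
      constructor
      · rintro ⟨w, hw, h1, h2⟩
        rw [Finset.sum_insert ha] at h1 h2
        exact ⟨w a, hw a (by simp), w, fun v hv => hw v (by simp [hv]), by rw [← h1]; ring,
          by rw [← h2]; abel⟩
      · rintro ⟨t, ht, w, hw, h1, h2⟩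
        have c : ∀ v ∈ V, Function.update w a t v = w v := fun v hv =>
          Function.update_of_ne (ne_of_mem_of_not_mem hv ha) _ _
        refine ⟨Function.update w a t, ?_, ?_, ?_⟩
        · intro v hv
          rcases Finset.mem_insert.1 hv with rfl | hv
          · simpa using ht
          · rw [c v hv]; exact hw v hv
        · rw [Finset.sum_insert ha, Finset.sum_congr rfl c, h1]; simp
        · rw [Finset.sum_insert ha, Finset.sum_congr rfl (fun v hv => by rw [c v hv]), h2]; simp
    rw [key]
    have e2 : ∀ f g : EuclideanSpace ℝ (Fin n) × ℝ,
        ⟪(α f • g - α g • f).1, x⟫_ℝ + (α f • g - α g • f).2 * s =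
        α f * (⟪g.1, x⟫_ℝ + g.2 * s) - α g * (⟪f.1, x⟫_ℝ + f.2 * s) := by
      intro f g
      simp only [Prod.fst_sub, Prod.snd_sub, Prod.smul_fst, Prod.smul_snd, inner_sub_left,
        real_inner_smul_left, smul_eq_mul]
      ring
    constructor
    · rintro ⟨t, ht, h⟩ f hf
      rcases Finset.mem_union.1 hf with hf | hf
      · rw [Finset.mem_filter] at hf
        have := h f hf.1
        nlinarith [mul_nonneg ht hf.2]
      · obtain ⟨⟨f, g⟩, hp, rfl⟩ := Finset.mem_image.1 hf
        simp only [Finset.mem_product, Finset.mem_filter] at hp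
        rw [e2]
        have i1 := mul_nonneg hp.1.2 (h g hp.2.1)
        have i2 := mul_nonneg (neg_nonneg.2 hp.2.2.le) (h f hp.1.1)
        dsimp only
        nlinarith
    · intro h
      apply fm_one S α (fun f => ⟪f.1, x⟫_ℝ + f.2 * s)
      · intro f hf hf0
        exact h f (by simp [hf, hf0])
      · intro f hf g hg hf0 hg0
        rw [← e2]
        apply h
        apply Finset.mem_union_right
        exact Finset.mem_image.2 ⟨(f, g), by simp [hf, hg, hf0, hg0], rfl⟩

lemma polytope_hrep {n : ℕ} (V : Finset (EuclideanSpace ℝ (Fin n)))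
    (hne : (interior (convexHull ℝ (V : Set (EuclideanSpace ℝ (Fin n))))).Nonempty) :
    ∃ S : Finset (EuclideanSpace ℝ (Fin n) × ℝ),
      interior (convexHull ℝ (V : Set (EuclideanSpace ℝ (Fin n)))) =
        {x | ∀ f ∈ S, 0 < ⟪f.1, x⟫_ℝ + f.2} := by
  obtain ⟨S, hS⟩ := cone_hrep V
  have hC : ∀ x, x ∈ convexHull ℝ (V : Set (EuclideanSpace ℝ (Fin n))) ↔
      ∀ f ∈ S, 0 ≤ ⟪f.1, x⟫_ℝ + f.2 := by
    intro x
    rw [Finset.mem_convexHull', hS x 1]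
    simp
  refine ⟨S.filter (fun f => f.1 ≠ 0), ?_⟩
  apply Set.Subset.antisymm
  · intro x hx f hf
    rw [Finset.mem_filter] at hf
    have hcont : Filter.Tendsto (fun t : ℝ => x - t • f.1) (nhds 0) (nhds x) := by
      have : Continuous (fun t : ℝ => x - t • f.1) := by fun_prop
      simpa using this.tendsto 0
    have hev := hcont.eventually (isOpen_interior.mem_nhds hx)
    obtain ⟨ε, hε, hb⟩ := Metric.eventually_nhds_iff.1 hev
    have h1 := hb (y := ε / 2) (by rw [Real.dist_eq, sub_zero, abs_of_pos] <;> linarith)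
    have h2 := (hC _).1 (interior_subset h1) f hf.1
    rw [inner_sub_right, inner_smul_right] at h2
    have h3 : 0 < ⟪f.1, f.1⟫_ℝ := real_inner_self_pos.2 hf.2
    have h4 : 0 < ε / 2 * ⟪f.1, f.1⟫_ℝ := by positivity
    linarith
  · apply interior_maximal
    · intro x hx
      rw [hC]
      intro f hf
      by_cases h0 : f.1 = 0
      · obtain ⟨y, hy⟩ := hne
        have := (hC y).1 (interior_subset hy) f hf
        rw [h0, inner_zero_left] at this ⊢
        exact this
      · exact (hx f (by simp [hf, h0])).le
    · have : {x : EuclideanSpace ℝ (Fin n) | ∀ f ∈ S.filter (fun f => f.1 ≠ 0),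
          0 < ⟪f.1, x⟫_ℝ + f.2} = ⋂ f ∈ S.filter (fun f => f.1 ≠ 0),
          {x : EuclideanSpace ℝ (Fin n) | 0 < ⟪f.1, x⟫_ℝ + f.2} := by
        ext x; simp only [Set.mem_iInter, Set.mem_ofPred_eq]
      rw [this]
      apply isOpen_biInter_finset
      intro f _
      exact isOpen_lt continuous_const (by fun_prop)

/-- Uniform lower bound: pair with one representative vector of each sign pattern. -/
lemma sign_bound {n : ℕ} {ι : Type*} [Fintype ι] (ξ : ι → EuclideanSpace ℝ (Fin n)) :
    ∃ K : ℝ, 0 ≤ K ∧ ∀ (v : EuclideanSpace ℝ (Fin n)) (u : ι → ℝ),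
      (∀ i, SignType.sign (u i) = SignType.sign ⟪ξ i, v⟫_ℝ) →
      ∑ i, |u i| ≤ K * ‖∑ i, u i • ξ i‖ := by
  have step : ∀ σ : ι → SignType, ∃ K : ℝ, 0 ≤ K ∧ ∀ (v : EuclideanSpace ℝ (Fin n)) (u : ι → ℝ),
      (∀ i, SignType.sign ⟪ξ i, v⟫_ℝ = σ i) → (∀ i, SignType.sign (u i) = σ i) →
      ∑ i, |u i| ≤ K * ‖∑ i, u i • ξ i‖ := by
    intro σ
    by_cases hσ : ∃ v₀ : EuclideanSpace ℝ (Fin n), ∀ i, SignType.sign ⟪ξ i, v₀⟫_ℝ = σ i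
    · obtain ⟨v₀, hv₀⟩ := hσ
      refine ⟨(∑ i, |⟪ξ i, v₀⟫_ℝ|⁻¹) * ‖v₀‖, by positivity, fun v u _ hu => ?_⟩
      have hterm : ∀ i, u i * ⟪ξ i, v₀⟫_ℝ = |u i| * |⟪ξ i, v₀⟫_ℝ| := by
        intro i
        rw [← abs_mul, eq_comm, abs_eq_self]
        have h := (hu i).trans (hv₀ i).symm
        rcases lt_trichotomy (u i) 0 with h1 | h1 | h1
        · rw [sign_neg h1, eq_comm, sign_eq_neg_one_iff] at h
          exact mul_nonneg_of_nonpos_of_nonpos h1.le h.le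
        · simp [h1]
        · rw [sign_pos h1, eq_comm, sign_eq_one_iff] at h
          positivity
      have hpair : ∑ i, |u i| * |⟪ξ i, v₀⟫_ℝ| ≤ ‖∑ i, u i • ξ i‖ * ‖v₀‖ := by
        refine le_trans (le_of_eq ?_) (real_inner_le_norm _ _)
        rw [sum_inner]
        refine Finset.sum_congr rfl fun i _ => ?_
        rw [real_inner_smul_left, hterm]
      have hone : ∀ i, |u i| ≤ |⟪ξ i, v₀⟫_ℝ|⁻¹ * (‖∑ i, u i • ξ i‖ * ‖v₀‖) := by
        intro i
        by_cases h0 : ⟪ξ i, v₀⟫_ℝ = 0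
        · have h := (hu i).trans (hv₀ i).symm
          rw [h0, sign_zero, sign_eq_zero_iff] at h
          simp [h, h0]
        · have hp : 0 < |⟪ξ i, v₀⟫_ℝ| := abs_pos.2 h0
          rw [← div_eq_inv_mul, le_div_iff₀ hp]
          exact (Finset.single_le_sum (f := fun i => |u i| * |⟪ξ i, v₀⟫_ℝ|)
            (fun i _ => by positivity) (Finset.mem_univ i)).trans hpair
      calc ∑ i, |u i| ≤ ∑ i, |⟪ξ i, v₀⟫_ℝ|⁻¹ * (‖∑ i, u i • ξ i‖ * ‖v₀‖) :=
            Finset.sum_le_sum fun i _ => hone i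
        _ = _ := by rw [← Finset.sum_mul]; ring
    · exact ⟨0, le_rfl, fun v u hv _ => absurd ⟨v, hv⟩ hσ⟩
  choose K hK0 hK using step
  refine ⟨∑ σ, K σ, Finset.sum_nonneg fun σ _ => hK0 σ, fun v u h => ?_⟩
  refine (hK (fun i => SignType.sign ⟪ξ i, v⟫_ℝ) v u (fun _ => rfl) h).trans ?_
  gcongr
  exact Finset.single_le_sum (fun σ _ => hK0 σ) (Finset.mem_univ _)

/-- The Hilbert distance in terms of the defining affine functions. -/
lemma hilbert_formula {n : ℕ} {ι : Type*}
    (ξ : ι → EuclideanSpace ℝ (Fin n)) (c : ι → ℝ) (P : Set (EuclideanSpace ℝ (Fin n)))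
    (hopen : IsOpen P) (hbdd : Bornology.IsBounded P)
    (hP : ∀ x, x ∈ P ↔ ∀ i, 0 < ⟪ξ i, x⟫_ℝ + c i)
    (p q : EuclideanSpace ℝ (Fin n)) (hp : p ∈ P) (hq : q ∈ P) (hpq : p ≠ q) :
    ∃ A B : ℝ, 0 ≤ A ∧ 0 ≤ B ∧ hilbertDist P p q = (A + B) / 2 ∧
      (∀ i, Real.log (⟪ξ i, q⟫_ℝ + c i) - Real.log (⟪ξ i, p⟫_ℝ + c i) ≤ A) ∧
      (∀ i, -B ≤ Real.log (⟪ξ i, q⟫_ℝ + c i) - Real.log (⟪ξ i, p⟫_ℝ + c i)) ∧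
      (∃ i, Real.log (⟪ξ i, q⟫_ℝ + c i) - Real.log (⟪ξ i, p⟫_ℝ + c i) = A) ∧
      (∃ i, Real.log (⟪ξ i, q⟫_ℝ + c i) - Real.log (⟪ξ i, p⟫_ℝ + c i) = -B) := by
  rw [hilbertDist, if_neg hpq]
  set T : Set ℝ := {t : ℝ | p + t • (q - p) ∈ P} with hT
  have hcont : Continuous (fun t : ℝ => p + t • (q - p)) := by fun_prop
  have hTo : IsOpen T := hopen.preimage hcont
  have h0 : (0 : ℝ) ∈ T := by simpa [hT] using hp
  have h1 : (1 : ℝ) ∈ T := by simpa [hT] using hq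
  have hTb : Bornology.IsBounded T := by
    obtain ⟨R, hR⟩ := hbdd.exists_norm_le
    have hd : 0 < ‖q - p‖ := norm_pos_iff.2 (sub_ne_zero.2 hpq.symm)
    refine isBounded_iff_forall_norm_le.2 ⟨(R + ‖p‖) / ‖q - p‖, fun t ht => ?_⟩
    rw [le_div_iff₀ hd, ← norm_smul]
    calc ‖t • (q - p)‖ = ‖(p + t • (q - p)) - p‖ := by congr 1; abel
      _ ≤ ‖p + t • (q - p)‖ + ‖p‖ := norm_sub_le _ _
      _ ≤ R + ‖p‖ := by gcongr; exact hR _ ht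
  have hba : BddAbove T := hTb.bddAbove
  have hbb : BddBelow T := hTb.bddBelow
  set a := sInf T with ha
  set b := sSup T with hb
  have haT : a ∉ T := by
    intro h
    obtain ⟨ε, hε, hbl⟩ := Metric.isOpen_iff.1 hTo a h
    have : a - ε / 2 ∈ T := hbl (by rw [Metric.mem_ball, Real.dist_eq, abs_lt]; constructor <;> linarith)
    have := csInf_le hbb this
    linarith
  have hbT : b ∉ T := by
    intro h
    obtain ⟨ε, hε, hbl⟩ := Metric.isOpen_iff.1 hTo b h
    have : b + ε / 2 ∈ T := hbl (by rw [Metric.mem_ball, Real.dist_eq, abs_lt]; constructor <;> linarith)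
    have := le_csSup hba this
    linarith
  have ha0 : a < 0 := lt_of_le_of_ne (csInf_le hbb h0) (fun h => haT (h ▸ h0))
  have hb1 : 1 < b := lt_of_le_of_ne (le_csSup hba h1) (fun h => hbT (h ▸ h1))
  set x : ι → ℝ := fun i => ⟪ξ i, p⟫_ℝ + c i with hx
  set y : ι → ℝ := fun i => ⟪ξ i, q⟫_ℝ + c i with hy
  have hx0 : ∀ i, 0 < x i := (hP p).1 hp
  have hy0 : ∀ i, 0 < y i := (hP q).1 hq
  have hmem : ∀ t, t ∈ T ↔ ∀ i, 0 < x i + t * (y i - x i) := by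
    intro t
    have : t ∈ T ↔ p + t • (q - p) ∈ P := Iff.rfl
    rw [this, hP]
    refine forall_congr' fun i => ?_
    have : ⟪ξ i, p + t • (q - p)⟫_ℝ + c i = x i + t * (y i - x i) := by
      simp only [hx, hy, inner_add_right, inner_smul_right, inner_sub_right]; ring
    rw [this]
  have hcl : ∀ t ∈ closure T, ∀ i, 0 ≤ x i + t * (y i - x i) := by
    intro t ht i
    have hc : IsClosed {t : ℝ | 0 ≤ x i + t * (y i - x i)} :=
      isClosed_le continuous_const (by fun_prop)
    exact closure_minimal (fun t ht => ((hmem t).1 ht i).le) hc ht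
  have hac := hcl a (csInf_mem_closure ⟨0, h0⟩ hbb)
  have hbc := hcl b (csSup_mem_closure ⟨0, h0⟩ hba)
  obtain ⟨j, hj⟩ : ∃ j, x j + a * (y j - x j) ≤ 0 := by
    by_contra hcon; push Not at hcon; exact haT ((hmem a).2 hcon)
  obtain ⟨k, hk⟩ : ∃ k, x k + b * (y k - x k) ≤ 0 := by
    by_contra hcon; push Not at hcon; exact hbT ((hmem b).2 hcon)
  have hA1 : 1 ≤ (1 - a) / (-a) := by rw [le_div_iff₀ (by linarith)]; linarith
  have hB1 : 1 ≤ b / (b - 1) := by rw [le_div_iff₀ (by linarith)]; linarith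
  refine ⟨Real.log ((1 - a) / (-a)), Real.log (b / (b - 1)), Real.log_nonneg hA1,
    Real.log_nonneg hB1, ?_, fun i => ?_, fun i => ?_, ⟨j, ?_⟩, ⟨k, ?_⟩⟩
  · rw [Real.log_mul (by positivity) (by positivity)]; ring
  · change Real.log (y i) - Real.log (x i) ≤ _
    rw [← Real.log_div (hy0 i).ne' (hx0 i).ne']
    apply Real.log_le_log (div_pos (hy0 i) (hx0 i))
    rw [div_le_div_iff₀ (hx0 i) (by linarith)]
    nlinarith [hac i]
  · change _ ≤ Real.log (y i) - Real.log (x i)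
    rw [neg_le, neg_sub, ← Real.log_div (hx0 i).ne' (hy0 i).ne']
    apply Real.log_le_log (div_pos (hx0 i) (hy0 i))
    rw [div_le_div_iff₀ (hy0 i) (by linarith)]
    nlinarith [hbc i]
  · change Real.log (y j) - Real.log (x j) = _
    rw [← Real.log_div (hy0 j).ne' (hx0 j).ne']
    congr 1
    rw [div_eq_div_iff (hx0 j).ne' (by linarith)]
    linarith [hac j]
  · change Real.log (y k) - Real.log (x k) = _
    rw [← neg_sub, ← Real.log_div (hx0 k).ne' (hy0 k).ne']
    congr 2
    rw [div_eq_div_iff (hy0 k).ne' (by linarith)]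
    linarith [hbc k]

/-- The Hilbert geometry of (the interior of) an `n`-dimensional convex
polytope `P ⊆ ℝⁿ` is bi-Lipschitz equivalent to `n`-dimensional Euclidean space. -/
theorem polytope_hilbertGeometry_biLipschitz_euclidean {n : ℕ}
    (V : Finset (EuclideanSpace ℝ (Fin n))) (P : Set (EuclideanSpace ℝ (Fin n)))
    (hP : P = interior (convexHull ℝ (V : Set (EuclideanSpace ℝ (Fin n)))))
    (hPne : P.Nonempty) :
    ∃ (F : EuclideanSpace ℝ (Fin n) → EuclideanSpace ℝ (Fin n)) (L : ℝ), 1 ≤ L ∧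
      ∀ x ∈ P, ∀ y ∈ P,
        (1 / L) * ‖F x - F y‖ ≤ hilbertDist P x y ∧
          hilbertDist P x y ≤ L * ‖F x - F y‖ := by
  subst hP
  obtain ⟨S, hS⟩ := polytope_hrep V hPne
  set P := interior (convexHull ℝ (V : Set (EuclideanSpace ℝ (Fin n)))) with hPdef
  have hopen : IsOpen P := isOpen_interior
  have hbdd : Bornology.IsBounded P :=
    (isBounded_convexHull.2 V.finite_toSet.isBounded).subset interior_subset
  let ξ : S → EuclideanSpace ℝ (Fin n) := fun f => f.1.1
  let c : S → ℝ := fun f => f.1.2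
  have hP : ∀ x, x ∈ P ↔ ∀ i, 0 < ⟪ξ i, x⟫_ℝ + c i := by
    intro x
    rw [hS]
    exact ⟨fun h i => h i.1 i.2, fun h f hf => h ⟨f, hf⟩⟩
  obtain ⟨K, hK0, hK⟩ := sign_bound ξ
  let F : EuclideanSpace ℝ (Fin n) → EuclideanSpace ℝ (Fin n) :=
    fun x => ∑ i, Real.log (⟪ξ i, x⟫_ℝ + c i) • ξ i
  set M : ℝ := ∑ i, ‖ξ i‖ with hM
  have hM0 : 0 ≤ M := Finset.sum_nonneg fun i _ => norm_nonneg _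
  refine ⟨F, 1 + K + 2 * M, by linarith, fun p hp q hq => ?_⟩
  have hL : 0 < 1 + K + 2 * M := by linarith
  by_cases hpq : p = q
  · subst hpq
    simp [hilbertDist]
  obtain ⟨A, B, hA0, hB0, hd, hA, hB, ⟨j, hj⟩, ⟨k, hk⟩⟩ :=
    hilbert_formula ξ c P hopen hbdd hP p q hp hq hpq
  set u : S → ℝ := fun i => Real.log (⟪ξ i, q⟫_ℝ + c i) - Real.log (⟪ξ i, p⟫_ℝ + c i) with hu
  have hF : ‖F p - F q‖ = ‖∑ i, u i • ξ i‖ := by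
    rw [norm_sub_rev]
    congr 1
    simp only [F, hu, ← Finset.sum_sub_distrib, sub_smul]
  have hsign : ∀ i, SignType.sign (u i) = SignType.sign ⟪ξ i, q - p⟫_ℝ := by
    intro i
    have hp0 := (hP p).1 hp i
    have hq0 := (hP q).1 hq i
    rw [inner_sub_right]
    rcases lt_trichotomy ⟪ξ i, q⟫_ℝ ⟪ξ i, p⟫_ℝ with h | h | h
    · have := Real.log_lt_log hq0 (by linarith : ⟪ξ i, q⟫_ℝ + c i < ⟪ξ i, p⟫_ℝ + c i)
      rw [sign_neg (by simp only [hu]; linarith), sign_neg (by linarith)]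
    · simp only [hu, h, sub_self]
    · have := Real.log_lt_log hp0 (by linarith : ⟪ξ i, p⟫_ℝ + c i < ⟪ξ i, q⟫_ℝ + c i)
      rw [sign_pos (by simp only [hu]; linarith), sign_pos (by linarith)]
  have hlow := hK (q - p) u hsign
  rw [hd, hF]
  have hN := norm_nonneg (∑ i, u i • ξ i)
  constructor
  · rw [div_mul_eq_mul_div, one_mul, div_le_iff₀ hL]
    have h1 : ‖∑ i, u i • ξ i‖ ≤ (A + B) * M := by
      rw [hM, Finset.mul_sum]
      refine (norm_sum_le _ _).trans (Finset.sum_le_sum fun i _ => ?_)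
      rw [norm_smul, Real.norm_eq_abs]
      gcongr
      rw [abs_le]
      have := hA i
      have := hB i
      simp only [hu]
      constructor <;> linarith
    nlinarith [mul_nonneg (add_nonneg hA0 hB0) hK0]
  · have hjA : A ≤ ∑ i, |u i| := by
      rw [← hj]
      exact (le_abs_self _).trans
        (Finset.single_le_sum (f := fun i => |u i|) (fun i _ => abs_nonneg _) (Finset.mem_univ j))
    have hkB : B ≤ ∑ i, |u i| := by
      have : B = -(u k) := by simp only [hu]; linarith
      rw [this]
      exact (neg_le_abs _).trans
        (Finset.single_le_sum (f := fun i => |u i|) (fun i _ => abs_nonneg _) (Finset.mem_univ k))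
    nlinarith [mul_nonneg hM0 hN]
end

section
/- Let P ⊂ ℝ^n be an n-dimensional compact convex polytope with barycenter at the origin, and let S be one of the cell-simplices of its barycentric cell decomposition, with vertices v_0, …, v_n, where v_n is the barycenter of P and, for k = n−1, …, 0, v_k is the barycenter of a k-dimensional face of P in a complete flag. Let L be the affine bijection from the affine hull of S onto the hyperplane {x ∈ ℝ^{n+1} : x_1 + ⋯ + x_{n+1} = 1} sending v_k to the point v̂_k = (1/(k+1), …, 1/(k+1), 0, …, 0) (with k+1 coordinates equal to 1/(k+1)), extended to an affine bijection of ℝ^n onto this hyperplane, and put P' = L(P). Then there exists a constant k ≥ 1 such that for every x in the intersection of the standard n-cell-simplex S_n with the interior of P' (equivalently with the relative interior of the standard simplex H_n) and every vector v tangent to the hyperplane, (1/k)·F_{P'}(x,v) ≤ F_{H_n}(x,v) ≤ k·F_{P'}(x,v). -/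
open Classical

/-- The Finsler norm of a convex domain `C`: for `v ≠ 0`, the line `t ↦ p + t • v` meets `∂C`
at the parameters `t⁻ = sInf` and `t⁺ = sSup` of the chord parameter set, with
`‖p - p⁻‖ = (-t⁻)·‖v‖` and `‖p - p⁺‖ = t⁺·‖v‖`, so that
`F_C(p,v) = (‖v‖/2)·(1/‖p-p⁻‖ + 1/‖p-p⁺‖) = (1/2)·(1/(-t⁻) + 1/t⁺)`.
(When the chord is unbounded on one side, the corresponding term is `0`.) -/
noncomputable def finslerNorm {E : Type*} [NormedAddCommGroup E] [NormedSpace ℝ E]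
    (C : Set E) (p v : E) : ℝ :=
  if v = 0 then 0
  else ((1 : ℝ) / 2) *
    (1 / (-sInf {t : ℝ | p + t • v ∈ C}) + 1 / sSup {t : ℝ | p + t • v ∈ C})

/-- Two points `A, B` of a convex set `K` are directly face-related if `A = B` or there is a
segment `[C, D] ⊆ K` containing the segment `[A, B]` with `C ∉ {A, B}` and `D ∉ {A, B}`. -/
def FaceRel {E : Type*} [AddCommGroup E] [Module ℝ E] (K : Set E) (A B : E) : Prop :=
  A ∈ K ∧ B ∈ K ∧ (A = B ∨ ∃ C D : E, segment ℝ C D ⊆ K ∧ segment ℝ A B ⊆ segment ℝ C D ∧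
    C ≠ A ∧ C ≠ B ∧ D ≠ A ∧ D ≠ B)

/-- A face of a convex set `K` is an equivalence class of the equivalence relation generated
by `FaceRel K`. -/
def IsFace {E : Type*} [AddCommGroup E] [Module ℝ E] (K F : Set E) : Prop :=
  ∃ A ∈ K, F = {B | Relation.EqvGen (FaceRel K) A B}

/-- The dimension of a subset of a vector space: the dimension of its affine span. -/
noncomputable def dimSet {E : Type*} [NormedAddCommGroup E] [NormedSpace ℝ E]
    (F : Set E) : ℕ :=
  Module.finrank ℝ (affineSpan ℝ F).direction

/-- The barycenter (centroid) of a `k`-dimensional subset of `ℝⁿ`, computed with respect to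
the `k`-dimensional Hausdorff measure. -/
noncomputable def centroid {n : ℕ} (k : ℝ) (f : Set (EuclideanSpace ℝ (Fin n))) :
    EuclideanSpace ℝ (Fin n) :=
  ((MeasureTheory.Measure.hausdorffMeasure k f).toReal)⁻¹ •
    ∫ x in f, x ∂(MeasureTheory.Measure.hausdorffMeasure (X := EuclideanSpace ℝ (Fin n)) k)

/-- A complete flag of faces `f 0 ⊊ f 1 ⊊ ⋯ ⊊ f (n-1)` of `P`, where `f k` is a face of
dimension `k` (inclusions are between the closures of the faces). -/
def IsCompleteFlag {n : ℕ} (P : Set (EuclideanSpace ℝ (Fin n)))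
    (f : Fin n → Set (EuclideanSpace ℝ (Fin n))) : Prop :=
  (∀ k : Fin n, IsFace P (f k) ∧ dimSet (f k) = (k : ℕ)) ∧
    ∀ (k : ℕ) (h : k + 1 < n),
      closure (f ⟨k, Nat.lt_of_succ_lt h⟩) ⊂ closure (f ⟨k + 1, h⟩)

/-- The vertices of the cell-simplex associated to a complete flag `f` of `P`: the barycenters
`b(f 0), …, b(f (n-1))` together with the barycenter of `P`. -/
noncomputable def cellPts {n : ℕ} (P : Set (EuclideanSpace ℝ (Fin n)))
    (f : Fin n → Set (EuclideanSpace ℝ (Fin n))) : Fin (n + 1) → EuclideanSpace ℝ (Fin n) :=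
  fun k => if h : (k : ℕ) < n then centroid k (f ⟨k, h⟩) else centroid n P

/-- The cell-simplex associated to a complete flag `f` of `P`: the convex hull of the
barycenters `b(f 0), …, b(f (n-1)), b(P)`. -/
noncomputable def cellSimplex {n : ℕ} (P : Set (EuclideanSpace ℝ (Fin n)))
    (f : Fin n → Set (EuclideanSpace ℝ (Fin n))) : Set (EuclideanSpace ℝ (Fin n)) :=
  convexHull ℝ (Set.range (cellPts P f))

section ConeLemmas

variable {E : Type*} [NormedAddCommGroup E] [NormedSpace ℝ E]

/-- `u` is a feasible direction of `P` at `q`. -/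
def InCone (P : Set E) (q u : E) : Prop := ∃ ε : ℝ, 0 < ε ∧ q + ε • u ∈ P

theorem InCone.zero {P : Set E} {q : E} (hq : q ∈ P) : InCone P q 0 :=
  ⟨1, one_pos, by simpa using hq⟩

theorem InCone.smul {P : Set E} {q u : E} (hq : q ∈ P) (h : InCone P q u) {c : ℝ} (hc : 0 ≤ c) :
    InCone P q (c • u) := by
  rcases hc.eq_or_lt with rfl | hc
  · simpa using InCone.zero hq
  · obtain ⟨ε, hε, h⟩ := h
    refine ⟨ε / c, by positivity, ?_⟩
    rw [smul_smul, div_mul_cancel₀ _ hc.ne']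
    exact h

theorem InCone.add {P : Set E} (hP : Convex ℝ P) {q u v : E}
    (h : InCone P q u) (h' : InCone P q v) : InCone P q (u + v) := by
  obtain ⟨a, ha, h⟩ := h
  obtain ⟨b, hb, h'⟩ := h'
  have hab : 0 < a + b := by positivity
  refine ⟨a * b / (a + b), by positivity, ?_⟩
  have := hP h h' (a := b / (a + b)) (b := a / (a + b)) (by positivity) (by positivity)
    (by field_simp; ring)
  convert this using 1
  have e1 : q = (b / (a + b)) • q + (a / (a + b)) • q := by
    rw [← add_smul]
    have : b / (a + b) + a / (a + b) = 1 := by field_simp; ring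
    rw [this, one_smul]
  have e2 : b / (a + b) * a = a * b / (a + b) := by ring
  have e3 : a / (a + b) * b = a * b / (a + b) := by ring
  rw [smul_add, smul_add, smul_add, smul_smul, smul_smul, e2, e3]
  nth_rewrite 1 [e1]
  abel

theorem InCone.sum {P : Set E} (hP : Convex ℝ P) {q : E} (hq : q ∈ P) {ι : Type*} (s : Finset ι)
    (u : ι → E) (h : ∀ i ∈ s, InCone P q (u i)) : InCone P q (∑ i ∈ s, u i) := by
  induction s using Finset.induction_on with
  | empty => simpa using InCone.zero hq
  | insert a s ha ih =>
    rw [Finset.sum_insert ha]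
    exact (h _ (by simp)).add hP (ih fun i hi => h i (by simp [hi]))

theorem InCone.sub_mem {P : Set E} {q p : E} (hp : p ∈ P) : InCone P q (p - q) :=
  ⟨1, one_pos, by simpa using hp⟩

theorem InCone.mem_le {P : Set E} (hP : Convex ℝ P) {q u : E} (hq : q ∈ P) {a b : ℝ} (hb : 0 ≤ b)
    (hba : b ≤ a) (h : q + a • u ∈ P) : q + b • u ∈ P := by
  rcases hb.eq_or_lt with rfl | hb
  · simpa using hq
  have ha : 0 < a := hb.trans_le hba
  have := hP hq h (a := 1 - b / a) (b := b / a) (by rw [sub_nonneg, div_le_one ha]; exact hba)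
    (by positivity) (by ring)
  convert this using 1
  rw [sub_smul, smul_add, smul_smul, div_mul_cancel₀ _ ha.ne', one_smul]
  abel

/-- Every point of a polytope has an exposing functional of its minimal face. -/
theorem exists_exposing [FiniteDimensional ℝ E] (V : Finset E) (q : E)
    (hq : q ∈ convexHull ℝ (V : Set E)) :
    ∃ l : E →L[ℝ] ℝ, (∀ p ∈ convexHull ℝ (V : Set E), l q ≤ l p) ∧
      ∀ p ∈ convexHull ℝ (V : Set E), l p = l q → InCone (convexHull ℝ (V : Set E)) q (q - p) := by
  classical
  set P := convexHull ℝ (V : Set E) with hPdef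
  have hP : Convex ℝ P := convex_convexHull ℝ _
  have hVP : ∀ w ∈ V, w ∈ P := fun w hw => subset_convexHull ℝ _ hw
  set VQ := V.filter (fun w => InCone P q (q - w)) with hVQ
  set W : Submodule ℝ E := Submodule.span ℝ ((fun w => w - q) '' (VQ : Set E)) with hW
  have hWc : ∀ u ∈ W, InCone P q u ∧ InCone P q (-u) := by
    intro u hu
    induction hu using Submodule.span_induction with
    | mem x hx =>
      obtain ⟨w, hw, rfl⟩ := hx
      have hw' : w ∈ V ∧ InCone P q (q - w) := by simpa [hVQ] using hw
      exact ⟨InCone.sub_mem (hVP w hw'.1), by simpa using hw'.2⟩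
    | zero => exact ⟨InCone.zero hq, by simpa using InCone.zero hq⟩
    | add x y _ _ hx hy =>
      refine ⟨hx.1.add hP hy.1, ?_⟩
      rw [neg_add]
      exact hx.2.add hP hy.2
    | smul a x _ hx =>
      rcases le_total 0 a with ha | ha
      · refine ⟨hx.1.smul hq ha, ?_⟩
        rw [← smul_neg]
        exact hx.2.smul hq ha
      · constructor
        · have := hx.2.smul hq (neg_nonneg.2 ha)
          simpa using this
        · have := hx.1.smul hq (neg_nonneg.2 ha)
          simpa using this
  set T : Finset E := (V \ VQ).image (fun w => w - q) with hT
  have hdisj : Disjoint (convexHull ℝ (T : Set E)) (W : Set E) := by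
    rw [Set.disjoint_left]
    intro y hy hyW
    rw [Finset.mem_convexHull'] at hy
    obtain ⟨μ, hμ0, hμ1, hμy⟩ := hy
    have : ∃ t ∈ T, 0 < μ t := by
      by_contra! hcon
      have : ∑ t ∈ T, μ t ≤ 0 := Finset.sum_nonpos hcon
      linarith
    obtain ⟨t, ht, hμt⟩ := this
    obtain ⟨w, hw, hwt⟩ := Finset.mem_image.1 ht
    have hwV : w ∈ V ∧ w ∉ VQ := by simpa using hw
    apply hwV.2
    rw [hVQ, Finset.mem_filter]
    refine ⟨hwV.1, ?_⟩
    have h1 : InCone P q (-y) := (hWc y hyW).2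
    have h2 : InCone P q (∑ s ∈ T.erase t, μ s • s) := by
      apply InCone.sum hP hq
      intro s hs
      obtain ⟨w', hw', rfl⟩ := Finset.mem_image.1 (Finset.mem_of_mem_erase hs)
      have hw'' : w' ∈ V ∧ w' ∉ VQ := by simpa using hw'
      exact (InCone.sub_mem (hVP w' hw''.1)).smul hq (hμ0 _ (Finset.mem_of_mem_erase hs))
    have h3 := (h1.add hP h2).smul hq (inv_nonneg.2 hμt.le)
    have h4 : -y + ∑ s ∈ T.erase t, μ s • s = -(μ t • t) := by
      rw [← hμy, ← Finset.add_sum_erase T _ ht]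
      abel
    rw [h4, smul_neg, smul_smul, inv_mul_cancel₀ hμt.ne', one_smul, ← hwt] at h3
    simpa using h3
  obtain ⟨g, a, b, hga, hab, hgb⟩ := geometric_hahn_banach_compact_closed
    (convex_convexHull ℝ (T : Set E)) (T.finite_toSet.isCompact_convexHull (𝕜 := ℝ)) W.convex
    W.closed_of_finiteDimensional hdisj
  have hb0 : b < 0 := by simpa using hgb 0 W.zero_mem
  have hgW : ∀ u ∈ W, g u = 0 := by
    intro u hu
    by_contra hne
    have := hgb ((b / g u) • u) (W.smul_mem _ hu)
    rw [map_smul, smul_eq_mul, div_mul_cancel₀ _ hne] at this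
    exact lt_irrefl _ this
  have hVle : ∀ w ∈ V, g (w - q) ≤ 0 ∧ (g (w - q) = 0 → w ∈ VQ) := by
    intro w hw
    by_cases hwQ : w ∈ VQ
    · refine ⟨(hgW _ (Submodule.subset_span ⟨w, hwQ, rfl⟩)).le, fun _ => hwQ⟩
    · have : g (w - q) < 0 := by
        have := hga (w - q) (subset_convexHull ℝ _ (by
          rw [hT]
          exact Finset.mem_coe.2 (Finset.mem_image_of_mem _ (by simp [hw, hwQ]))))
        linarith
      exact ⟨this.le, fun h => absurd h this.ne⟩
  have key : ∀ p ∈ P, g (p - q) ≤ 0 ∧ (g (p - q) = 0 → InCone P q (q - p)) := by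
    intro p hp
    rw [hPdef, Finset.mem_convexHull'] at hp
    obtain ⟨μ, hμ0, hμ1, hμy⟩ := hp
    have e : p - q = ∑ w ∈ V, μ w • (w - q) := by
      simp_rw [smul_sub, Finset.sum_sub_distrib, ← Finset.sum_smul]
      rw [hμ1, hμy, one_smul]
    have e2 : g (p - q) = ∑ w ∈ V, μ w * g (w - q) := by
      rw [e, map_sum]
      simp
    have hle : ∀ w ∈ V, μ w * g (w - q) ≤ 0 := fun w hw =>
      mul_nonpos_of_nonneg_of_nonpos (hμ0 w hw) (hVle w hw).1
    refine ⟨e2 ▸ Finset.sum_nonpos hle, fun h0 => ?_⟩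
    rw [e2, Finset.sum_eq_zero_iff_of_nonpos hle] at h0
    have e3 : q - p = ∑ w ∈ V, μ w • (q - w) := by
      rw [← neg_sub, e, ← Finset.sum_neg_distrib]
      refine Finset.sum_congr rfl fun w _ => ?_
      rw [← smul_neg, neg_sub]
    rw [e3]
    apply InCone.sum hP hq
    intro w hw
    rcases mul_eq_zero.1 (h0 w hw) with h | h
    · rw [h, zero_smul]
      exact InCone.zero hq
    · have := (hVle w hw).2 h
      rw [hVQ, Finset.mem_filter] at this
      exact this.2.smul hq (hμ0 w hw)
  refine ⟨-g, fun p hp => ?_, fun p hp h => (key p hp).2 ?_⟩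
  · have := (key p hp).1
    rw [map_sub] at this
    simp only [neg_apply]
    linarith
  · simp only [neg_apply] at h
    rw [map_sub]
    linarith

/-- Points in the same face, as used for open faces. -/
theorem eqvGen_faceRel {P : Set E} (hP : Convex ℝ P) {A B : E}
    (h : Relation.EqvGen (FaceRel P) A B) :
    A = B ∨ (A ∈ P ∧ B ∈ P ∧ InCone P A (A - B) ∧ InCone P B (B - A)) := by
  have hstep : ∀ A B C D : E, segment ℝ C D ⊆ P → segment ℝ A B ⊆ segment ℝ C D → C ≠ A → C ≠ B →
      D ≠ A → D ≠ B → InCone P A (A - B) := by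
    intro A B C D hCD hAB hCA hCB hDA hDB
    by_cases hne : A = B
    · subst hne
      simpa using InCone.zero (hCD (hAB (left_mem_segment ℝ A A)))
    have hCP : C ∈ P := hCD (left_mem_segment ℝ C D)
    have hDP : D ∈ P := hCD (right_mem_segment ℝ C D)
    have hA := hAB (left_mem_segment ℝ A B)
    have hB := hAB (right_mem_segment ℝ A B)
    rw [segment_eq_image'] at hA hB
    obtain ⟨s, ⟨hs0, hs1⟩, hA⟩ := hA
    obtain ⟨t, ⟨ht0, ht1⟩, hB⟩ := hB
    have hAP : A ∈ P := hCD (hAB (left_mem_segment ℝ A B))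
    simp only at hA hB
    have hs0' : 0 < s := by
      rcases hs0.eq_or_lt with h | h
      · exact absurd (by rw [← hA, ← h]; simp) hCA
      · exact h
    have hs1' : s < 1 := by
      rcases hs1.eq_or_lt with h | h
      · exact absurd (by rw [← hA, h]; simp) hDA
      · exact h
    have h1 : InCone P A (D - C) := by
      have := (InCone.sub_mem (q := A) hDP).smul hAP (c := (1 - s)⁻¹) (by
        rw [inv_nonneg]; linarith)
      have e : D - A = (1 - s) • (D - C) := by
        rw [← hA, sub_smul, one_smul]; abel
      rwa [e, smul_smul, inv_mul_cancel₀ (by linarith), one_smul] at this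
    have h2 : InCone P A (-(D - C)) := by
      have := (InCone.sub_mem (q := A) hCP).smul hAP (c := s⁻¹) (by positivity)
      have e : C - A = s • (-(D - C)) := by
        rw [← hA, smul_neg]; abel
      rwa [e, smul_smul, inv_mul_cancel₀ hs0'.ne', one_smul] at this
    have e : A - B = (s - t) • (D - C) := by
      rw [← hA, ← hB, sub_smul]; abel
    rw [e]
    rcases le_total t s with h | h
    · exact h1.smul hAP (by linarith)
    · have := h2.smul hAP (c := t - s) (by linarith)
      rwa [smul_neg, ← neg_smul, neg_sub] at this
  have htrans : ∀ A B C : E, A ∈ P → C ∈ P → InCone P A (A - B) → InCone P B (B - C) →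
      InCone P A (A - C) := by
    rintro A B C hA hC h ⟨δ, hδ, h'⟩
    have h1 := InCone.sub_mem (q := A) h'
    have h2 := (h1.add hP h).smul hA (inv_nonneg.2 hδ.le)
    have e : B + δ • (B - C) - A + (A - B) = δ • (B - C) := by abel
    rw [e, smul_smul, inv_mul_cancel₀ hδ.ne', one_smul] at h2
    have := h.add hP h2
    simpa using this
  induction h with
  | rel x y h =>
    obtain ⟨hx, hy, h | ⟨C, D, hCD, hAB, h1, h2, h3, h4⟩⟩ := h
    · exact Or.inl h
    · exact Or.inr ⟨hx, hy, hstep x y C D hCD hAB h1 h2 h3 h4,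
        hstep y x C D hCD (by rwa [segment_symm]) h2 h1 h4 h3⟩
  | refl x => exact Or.inl rfl
  | symm x y _ ih =>
    rcases ih with h | ⟨h1, h2, h3, h4⟩
    · exact Or.inl h.symm
    · exact Or.inr ⟨h2, h1, h4, h3⟩
  | trans x y z _ _ ih1 ih2 =>
    rcases ih1 with rfl | ⟨h1, h2, h3, h4⟩
    · exact ih2
    · rcases ih2 with rfl | ⟨g1, g2, g3, g4⟩
      · exact Or.inr ⟨h1, h2, h3, h4⟩
      · exact Or.inr ⟨h1, g2, htrans _ _ _ h1 g2 h3 g3, htrans _ _ _ g2 h1 g4 h4⟩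

theorem faceRel_of_inCone {P : Set E} (hP : Convex ℝ P) {A B : E} (hA : A ∈ P) (hB : B ∈ P)
    (h : InCone P A (A - B)) (h' : InCone P B (B - A)) : FaceRel P A B := by
  refine ⟨hA, hB, ?_⟩
  by_cases hne : A = B
  · exact Or.inl hne
  right
  obtain ⟨a, ha, h⟩ := h
  obtain ⟨b, hb, h'⟩ := h'
  have hAB : A - B ≠ 0 := sub_ne_zero.2 hne
  have hab : 0 < 1 + a + b := by positivity
  refine ⟨A + a • (A - B), B + b • (B - A), hP.segment_subset h h', ?_, ?_, ?_, ?_, ?_⟩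
  · apply (convex_segment _ _).segment_subset
    · rw [segment_eq_image']
      refine ⟨a / (1 + a + b), ⟨by positivity, by rw [div_le_one hab]; linarith⟩, ?_⟩
      have : B + b • (B - A) - (A + a • (A - B)) = -((1 + a + b) • (A - B)) := by
        module
      simp only [this]
      rw [smul_neg, smul_smul, div_mul_cancel₀ _ hab.ne']
      abel
    · rw [segment_eq_image']
      refine ⟨(1 + a) / (1 + a + b), ⟨by positivity, by rw [div_le_one hab]; linarith⟩, ?_⟩
      have : B + b • (B - A) - (A + a • (A - B)) = -((1 + a + b) • (A - B)) := by
        module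
      simp only [this]
      rw [smul_neg, smul_smul, div_mul_cancel₀ _ hab.ne']
      module
  · intro h
    have : a • (A - B) = 0 := by simpa using h
    rcases smul_eq_zero.1 this with h | h
    · exact ha.ne' h
    · exact hAB h
  · intro h
    have : (1 + a) • (A - B) = 0 := by
      rw [add_smul, one_smul, ← sub_eq_zero.2 h]; abel
    rcases smul_eq_zero.1 this with h | h
    · linarith
    · exact hAB h
  · intro h
    have : (1 + b) • (A - B) = 0 := by
      rw [← neg_eq_zero, ← sub_eq_zero.2 h]; module
    rcases smul_eq_zero.1 this with h | h
    · linarith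
    · exact hAB h
  · intro h
    have : b • (A - B) = 0 := by
      rw [← neg_eq_zero, ← sub_eq_zero.2 h]; module
    rcases smul_eq_zero.1 this with h | h
    · exact hb.ne' h
    · exact hAB h

end ConeLemmas

section Centroid

open MeasureTheory

variable {n : ℕ}

theorem integrableOn_id_of_bounded {μ : Measure (EuclideanSpace ℝ (Fin n))}
    {s : Set (EuclideanSpace ℝ (Fin n))} (hs : μ s ≠ ⊤) (hb : Bornology.IsBounded s) :
    IntegrableOn (fun x => x) s μ := by
  obtain ⟨R, hR⟩ := hb.exists_norm_le
  refine Measure.integrableOn_of_bounded (M := R) hs aestronglyMeasurable_id ?_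
  rw [ae_restrict_iff (isClosed_le continuous_norm continuous_const).measurableSet]
  exact Filter.Eventually.of_forall hR

theorem centroid_eq_setAverage (k : ℝ) (s : Set (EuclideanSpace ℝ (Fin n))) :
    centroid k s = ⨍ x in s, x ∂(Measure.hausdorffMeasure k) := by
  rw [setAverage_eq]
  rfl

theorem centroid_mem_of_subset {k : ℝ} {s T : Set (EuclideanSpace ℝ (Fin n))}
    (hs : (Measure.hausdorffMeasure k s).toReal ≠ 0) (hb : Bornology.IsBounded s)
    (hT : Convex ℝ T) (hTc : IsClosed T) (hsT : s ⊆ T) : centroid k s ∈ T := by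
  have hs' := ENNReal.toReal_ne_zero.1 hs
  rw [centroid_eq_setAverage]
  refine hT.set_average_mem hTc hs'.1 hs'.2 ?_ (integrableOn_id_of_bounded hs'.2 hb)
  rw [ae_restrict_iff (p := fun x => x ∈ T) (by simpa using hTc.measurableSet)]
  exact Filter.Eventually.of_forall hsT

theorem centroid_ae_eq {k : ℝ} {s : Set (EuclideanSpace ℝ (Fin n))}
    (hs : (Measure.hausdorffMeasure k s).toReal ≠ 0) (hb : Bornology.IsBounded s)
    (l : EuclideanSpace ℝ (Fin n) →L[ℝ] ℝ) (hl : ∀ x ∈ s, l (centroid k s) ≤ l x) :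
    ∀ᵐ x ∂(Measure.hausdorffMeasure k), x ∈ s → l x = l (centroid k s) := by
  have hs' := ENNReal.toReal_ne_zero.1 hs
  set μ : Measure (EuclideanSpace ℝ (Fin n)) := Measure.hausdorffMeasure k with hμ
  have hinteg := integrableOn_id_of_bounded hs'.2 hb
  set g := centroid k s with hg
  have h1 : ∫ x in s, l x ∂μ = (μ s).toReal * l g := by
    rw [l.integral_comp_comm hinteg, hg]
    simp only [centroid, map_smul, smul_eq_mul]
    rw [← mul_assoc, mul_inv_cancel₀ hs, one_mul]
  have hlint : IntegrableOn (fun x => l x) s μ := l.integrable_comp hinteg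
  have hcint : IntegrableOn (fun _ => l g) s μ := integrableOn_const hs'.2
  have h2 : ∫ x in s, (l x - l g) ∂μ = 0 := by
    rw [integral_sub hlint hcint, h1, setIntegral_const]
    simp [Measure.real]
  have h3 : 0 ≤ᵐ[μ.restrict s] fun x => l x - l g := by
    change ∀ᵐ x ∂(μ.restrict s), 0 ≤ l x - l g
    rw [ae_restrict_iff (isClosed_le continuous_const (by fun_prop)).measurableSet]
    exact Filter.Eventually.of_forall fun x hx => sub_nonneg.2 (hl x hx)
  rw [integral_eq_zero_iff_of_nonneg_ae h3 (hlint.sub hcint)] at h2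
  have h4 : ∀ᵐ x ∂(μ.restrict s), l x - l g = 0 := h2
  rw [ae_restrict_iff (isClosed_eq (by fun_prop) continuous_const).measurableSet] at h4
  filter_upwards [h4] with x hx hxs
  exact sub_eq_zero.1 (hx hxs)

theorem polytope_isCompact (V : Finset (EuclideanSpace ℝ (Fin n))) :
    IsCompact (convexHull ℝ (V : Set (EuclideanSpace ℝ (Fin n)))) :=
  V.finite_toSet.isCompact_convexHull (𝕜 := ℝ)

/-- The barycenter of an open face lies in the open face. -/
theorem centroid_mem_face (V : Finset (EuclideanSpace ℝ (Fin n))) {k : ℝ}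
    {F : Set (EuclideanSpace ℝ (Fin n))} (hF : IsFace (convexHull ℝ (V : Set _)) F)
    (hs : (Measure.hausdorffMeasure k F).toReal ≠ 0) : centroid k F ∈ F := by
  set P := convexHull ℝ (V : Set (EuclideanSpace ℝ (Fin n))) with hPdef
  have hP : Convex ℝ P := convex_convexHull ℝ _
  have hPc : IsCompact P := polytope_isCompact V
  obtain ⟨A₀, hA₀, hFA⟩ := hF
  have hmem : ∀ B, B ∈ F ↔ Relation.EqvGen (FaceRel P) A₀ B := fun B => by rw [hFA]; rfl
  have hFP : F ⊆ P := by
    intro B hB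
    rcases eqvGen_faceRel hP ((hmem B).1 hB) with h | h
    · rwa [← h]
    · exact h.2.1
  have hb : Bornology.IsBounded F := hPc.isBounded.subset hFP
  have hgP : centroid k F ∈ P := centroid_mem_of_subset hs hb hP hPc.isClosed hFP
  obtain ⟨l, hl1, hl2⟩ := exists_exposing V (centroid k F) hgP
  have hae := centroid_ae_eq hs hb l (fun x hx => hl1 x (hFP hx))
  obtain ⟨A, hAF, hlA⟩ : ∃ A ∈ F, l A = l (centroid k F) := by
    by_contra! hcon
    apply (ENNReal.toReal_ne_zero.1 hs).1
    refine measure_mono_null ?_ (ae_iff.1 hae)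
    intro x hx
    simp only [Set.mem_ofPred_eq]
    exact fun h => hcon x hx (h hx)
  have c1 : InCone P (centroid k F) (centroid k F - A) := hl2 A (hFP hAF) hlA
  obtain ⟨l', hl1', hl2'⟩ := exists_exposing V A (hFP hAF)
  have hF' : ∀ B ∈ F, l' B = l' A := by
    intro B hB
    have : Relation.EqvGen (FaceRel P) A B :=
      Relation.EqvGen.trans _ _ _ (Relation.EqvGen.symm _ _ ((hmem A).1 hAF)) ((hmem B).1 hB)
    rcases eqvGen_faceRel hP this with h | ⟨-, hBP, ⟨ε, hε, h⟩, -⟩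
    · rw [h]
    · have h1 := hl1' _ h
      have h2 := hl1' _ hBP
      simp only [map_add, map_smul, map_sub, smul_eq_mul] at h1
      nlinarith
  have hg : centroid k F ∈ {p | l' p = l' A} := by
    apply centroid_mem_of_subset hs hb _ _ (fun B hB => hF' B hB)
    · exact convex_hyperplane (LinearMap.isLinear l'.toLinearMap) _
    · exact isClosed_eq l'.continuous continuous_const
  have c2 : InCone P A (A - centroid k F) := hl2' _ hgP hg
  rw [hmem]
  exact Relation.EqvGen.trans _ _ _ ((hmem A).1 hAF)
    (Relation.EqvGen.rel _ _ (faceRel_of_inCone hP (hFP hAF) hgP c2 c1))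

theorem face_subset {P F : Set (EuclideanSpace ℝ (Fin n))} (hP : Convex ℝ P) (hF : IsFace P F) :
    F ⊆ P := by
  obtain ⟨A₀, hA₀, rfl⟩ := hF
  intro B hB
  rcases eqvGen_faceRel hP hB with h | h
  · rwa [← h]
  · exact h.2.1

/-- From a point of an open face one can move away from every point of the closed face. -/
theorem inCone_of_mem_closure_face (V : Finset (EuclideanSpace ℝ (Fin n)))
    {F : Set (EuclideanSpace ℝ (Fin n))} (hF : IsFace (convexHull ℝ (V : Set _)) F)
    {q p : EuclideanSpace ℝ (Fin n)} (hq : q ∈ F) (hp : p ∈ closure F) :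
    InCone (convexHull ℝ (V : Set _)) q (q - p) := by
  set P := convexHull ℝ (V : Set (EuclideanSpace ℝ (Fin n))) with hPdef
  have hP : Convex ℝ P := convex_convexHull ℝ _
  have hPc : IsCompact P := polytope_isCompact V
  have hFP := face_subset hP hF
  have hpP : p ∈ P := closure_minimal hFP hPc.isClosed hp
  obtain ⟨l, hl1, hl2⟩ := exists_exposing V q (hFP hq)
  refine hl2 p hpP ?_
  obtain ⟨A₀, hA₀, hFA⟩ := hF
  have : F ⊆ {x | l x = l q} := by
    intro B hB
    rw [hFA] at hB hq
    have : Relation.EqvGen (FaceRel P) q B :=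
      Relation.EqvGen.trans _ _ _ (Relation.EqvGen.symm _ _ hq) hB
    rcases eqvGen_faceRel hP this with h | ⟨-, hBP, ⟨ε, hε, h⟩, -⟩
    · simp [h]
    · have h1 := hl1 _ h
      have h2 := hl1 _ hBP
      simp only [map_add, map_smul, map_sub, smul_eq_mul] at h1
      simp only [Set.mem_ofPred_eq]
      nlinarith
  exact closure_minimal this (isClosed_eq l.continuous continuous_const) hp

/-- A point of the polytope opposite to which one can move lies in the span of the face. -/
theorem mem_affineSpan_of_inCone {P F : Set (EuclideanSpace ℝ (Fin n))} (hP : Convex ℝ P)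
    (hF : IsFace P F) {q p : EuclideanSpace ℝ (Fin n)} (hq : q ∈ F) (hp : p ∈ P)
    (h : InCone P q (q - p)) : p ∈ affineSpan ℝ F := by
  have hqP := face_subset hP hF hq
  set B : EuclideanSpace ℝ (Fin n) := q + (1 / 2 : ℝ) • (p - q) with hB
  have hBP : B ∈ P := by
    have := hP hqP hp (a := 1 / 2) (b := 1 / 2) (by norm_num) (by norm_num) (by norm_num)
    convert this using 1
    rw [hB]; module
  have h1 : InCone P q (q - B) := by
    have := h.smul hqP (c := 1 / 2) (by norm_num)
    convert this using 1
    rw [hB]; module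
  have h2 : InCone P B (B - q) := by
    have := InCone.sub_mem (q := B) hp
    convert this using 1
    rw [hB]; module
  have hBF : B ∈ F := by
    obtain ⟨A₀, hA₀, hFA⟩ := hF
    rw [hFA] at hq ⊢
    exact Relation.EqvGen.trans _ _ _ hq
      (Relation.EqvGen.rel _ _ (faceRel_of_inCone hP hqP hBP h1 h2))
  have := AffineMap.lineMap_mem (2 : ℝ) (subset_affineSpan ℝ F hq) (subset_affineSpan ℝ F hBF)
  convert this using 1
  rw [AffineMap.lineMap_apply_module, hB]
  module

/-- The barycenter of a full-dimensional polytope: one can move away from every point. -/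
theorem inCone_centroid_polytope (V : Finset (EuclideanSpace ℝ (Fin n)))
    (hdim : (interior (convexHull ℝ (V : Set (EuclideanSpace ℝ (Fin n))))).Nonempty) :
    centroid n (convexHull ℝ (V : Set (EuclideanSpace ℝ (Fin n)))) ∈ convexHull ℝ (V : Set _) ∧
    ∀ p ∈ convexHull ℝ (V : Set (EuclideanSpace ℝ (Fin n))),
      InCone (convexHull ℝ (V : Set _)) (centroid n (convexHull ℝ (V : Set _)))
        (centroid n (convexHull ℝ (V : Set _)) - p) := by
  set P := convexHull ℝ (V : Set (EuclideanSpace ℝ (Fin n))) with hPdef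
  have hP : Convex ℝ P := convex_convexHull ℝ _
  have hPc : IsCompact P := polytope_isCompact V
  have : (Measure.hausdorffMeasure (n : ℝ) :
      Measure (EuclideanSpace ℝ (Fin n))).IsAddHaarMeasure := by
    simpa using MeasureTheory.isAddHaarMeasure_hausdorffMeasure (E := EuclideanSpace ℝ (Fin n))
  have hs : (Measure.hausdorffMeasure (n : ℝ) P).toReal ≠ 0 := by
    rw [ENNReal.toReal_ne_zero]
    refine ⟨?_, hPc.measure_ne_top⟩
    exact (Measure.measure_pos_of_nonempty_interior _ hdim).ne'
  have hgP : centroid n P ∈ P := centroid_mem_of_subset hs hPc.isBounded hP hPc.isClosed subset_rfl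
  refine ⟨hgP, ?_⟩
  obtain ⟨l, hl1, hl2⟩ := exists_exposing V (centroid n P) hgP
  have hae := centroid_ae_eq hs hPc.isBounded l (fun x hx => hl1 x hx)
  have hzero : ∀ x ∈ interior P, l x = l (centroid n P) := by
    intro x hx
    by_contra hne
    have hopen : IsOpen (interior P ∩ {y | l y ≠ l (centroid n P)}) :=
      isOpen_interior.inter (isOpen_ne_fun l.continuous continuous_const)
    refine (hopen.measure_pos (Measure.hausdorffMeasure (n : ℝ)) ⟨x, hx, hne⟩).ne' ?_
    refine measure_mono_null ?_ (ae_iff.1 hae)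
    rintro y ⟨hy1, hy2⟩
    simp only [Set.mem_ofPred_eq]
    exact fun h => hy2 (h (interior_subset hy1))
  intro p hp
  refine hl2 p hp ?_
  have hcl : P ⊆ closure (interior P) := by
    rw [hP.closure_interior_eq_closure_of_nonempty_interior hdim]
    exact subset_closure
  have h2 : interior P ⊆ {x | l x = l (centroid n P)} := hzero
  exact closure_minimal h2 (isClosed_eq l.continuous continuous_const) (hcl hp)

end Centroid

section Finsler

theorem chord_compare {T U : Set ℝ} {c R : ℝ} (hc : 0 < c)
    (hT0 : ∃ δ > 0, ∀ t : ℝ, |t| < δ → t ∈ T)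
    (hTs : ∀ t ∈ T, ∀ r : ℝ, 0 ≤ r → r ≤ 1 → r * t ∈ T)
    (hTb : ∀ t ∈ T, |t| ≤ R) (hUb : ∀ t ∈ U, |t| ≤ R)
    (h : ∀ s : ℝ, 0 < s → s ∈ T → -s ∈ T → c * s ∈ U ∧ -(c * s) ∈ U) :
    (1 : ℝ) / 2 * (1 / (-sInf U) + 1 / sSup U) ≤
      2 / c * ((1 : ℝ) / 2 * (1 / (-sInf T) + 1 / sSup T)) := by
  obtain ⟨δ, hδ, hT0⟩ := hT0
  have bT : BddAbove T := ⟨R, fun t ht => (abs_le.1 (hTb t ht)).2⟩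
  have bT' : BddBelow T := ⟨-R, fun t ht => (abs_le.1 (hTb t ht)).1⟩
  have bU : BddAbove U := ⟨R, fun t ht => (abs_le.1 (hUb t ht)).2⟩
  have bU' : BddBelow U := ⟨-R, fun t ht => (abs_le.1 (hUb t ht)).1⟩
  have hz : (0 : ℝ) ∈ T := hT0 0 (by simpa using hδ)
  set b := sSup T with hb
  set a := -sInf T with ha
  have hbpos : 0 < b := by
    have : δ / 2 ≤ b := le_csSup bT (hT0 _ (by rw [abs_of_pos (by positivity)]; linarith))
    linarith
  have hapos : 0 < a := by
    have : sInf T ≤ -(δ / 2) := csInf_le bT' (hT0 _ (by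
      rw [abs_neg, abs_of_pos (by positivity)]; linarith))
    linarith
  have key : ∀ s : ℝ, 0 < s → s < a → s < b → c * s ≤ sSup U ∧ c * s ≤ -sInf U := by
    intro s hs hsa hsb
    have h1 : s ∈ T := by
      obtain ⟨t, ht, hst⟩ := exists_lt_of_lt_csSup ⟨0, hz⟩ hsb
      have htp : 0 < t := hs.trans hst
      have := hTs t ht (s / t) (by positivity) (by rw [div_le_one htp]; exact hst.le)
      rwa [div_mul_cancel₀ _ htp.ne'] at this
    have h2 : -s ∈ T := by
      obtain ⟨t, ht, hst⟩ := exists_lt_of_csInf_lt ⟨0, hz⟩ (show sInf T < -s by linarith)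
      have htp : 0 < -t := by linarith
      have := hTs t ht (s / (-t)) (by positivity) (by rw [div_le_one htp]; linarith)
      have e : s / (-t) * t = -s := by
        have : t ≠ 0 := by linarith
        field_simp
      rwa [e] at this
    obtain ⟨h3, h4⟩ := h s hs h1 h2
    refine ⟨le_csSup bU h3, ?_⟩
    have := csInf_le bU' h4
    linarith
  set m := min a b with hm
  have hmpos : 0 < m := lt_min hapos hbpos
  have key2 : c * m ≤ sSup U ∧ c * m ≤ -sInf U := by
    have hlt : ∀ w : ℝ, (∀ s, 0 < s → s < m → c * s ≤ w) → c * m ≤ w := by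
      intro w hw
      have : m ≤ w / c := by
        apply le_of_forall_lt_imp_le_of_dense
        intro s hs
        rcases le_or_gt s 0 with h0 | h0
        · have := hw (m / 2) (by positivity) (by linarith)
          rw [le_div_iff₀ hc]
          nlinarith
        · rw [le_div_iff₀ hc, mul_comm]
          exact hw s h0 hs
      rwa [le_div_iff₀ hc, mul_comm] at this
    constructor
    · exact hlt _ fun s h0 h1 => (key s h0 (h1.trans_le (min_le_left _ _))
        (h1.trans_le (min_le_right _ _))).1
    · exact hlt _ fun s h0 h1 => (key s h0 (h1.trans_le (min_le_left _ _))
        (h1.trans_le (min_le_right _ _))).2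
  have hcm : 0 < c * m := by positivity
  have i1 : 1 / sSup U ≤ 1 / (c * m) := one_div_le_one_div_of_le hcm key2.1
  have i2 : 1 / (-sInf U) ≤ 1 / (c * m) := one_div_le_one_div_of_le hcm key2.2
  have i3 : 1 / m ≤ 1 / a + 1 / b := by
    have hA : 0 < 1 / a := by positivity
    have hB : 0 < 1 / b := by positivity
    rcases min_choice a b with h | h <;> rw [hm, h] <;> linarith
  have i4 : 1 / (c * m) ≤ 1 / c * (1 / a + 1 / b) := by
    have : 1 / (c * m) = 1 / c * (1 / m) := by field_simp
    rw [this]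
    exact mul_le_mul_of_nonneg_left i3 (by positivity)
  have e : 2 / c * ((1 : ℝ) / 2 * (1 / a + 1 / b)) = 1 / c * (1 / a + 1 / b) := by ring
  rw [e]
  linarith

variable {n : ℕ}

theorem mem_ri_iff {C : Set (EuclideanSpace ℝ (Fin (n + 1)))}
    (hC : ∀ x, x ∈ affineSpan ℝ C ↔ ∑ i, x i = 1) (x : EuclideanSpace ℝ (Fin (n + 1))) :
    x ∈ intrinsicInterior ℝ C ↔ ∑ i, x i = 1 ∧
      ∃ δ > 0, ∀ y : EuclideanSpace ℝ (Fin (n + 1)), ∑ i, y i = 1 → dist y x < δ → y ∈ C := by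
  rw [mem_intrinsicInterior]
  constructor
  · rintro ⟨y, hy, rfl⟩
    refine ⟨(hC _).1 y.2, ?_⟩
    rw [mem_interior_iff_mem_nhds, Metric.mem_nhds_iff] at hy
    obtain ⟨δ, hδ, h⟩ := hy
    refine ⟨δ, hδ, fun z hz hzd => ?_⟩
    exact h (show (⟨z, (hC z).2 hz⟩ : affineSpan ℝ C) ∈ Metric.ball y δ from hzd)
  · rintro ⟨hx, δ, hδ, h⟩
    refine ⟨⟨x, (hC x).2 hx⟩, ?_, rfl⟩
    rw [mem_interior_iff_mem_nhds, Metric.mem_nhds_iff]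
    exact ⟨δ, hδ, fun z hz => h z ((hC _).1 z.2) hz⟩

theorem ri_star {C : Set (EuclideanSpace ℝ (Fin (n + 1)))} (hCc : Convex ℝ C)
    (hC : ∀ x, x ∈ affineSpan ℝ C ↔ ∑ i, x i = 1) {x u : EuclideanSpace ℝ (Fin (n + 1))}
    (hx : x ∈ intrinsicInterior ℝ C) (hu : x + u ∈ C) {s : ℝ} (hs0 : 0 ≤ s) (hs1 : s < 1) :
    x + s • u ∈ intrinsicInterior ℝ C := by
  rw [mem_ri_iff hC] at hx ⊢
  obtain ⟨hx1, δ, hδ, h⟩ := hx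
  have hu1 := (hC _).1 (subset_affineSpan ℝ C hu)
  have hus : ∑ i, u i = 0 := by
    simp only [PiLp.add_apply, Finset.sum_add_distrib] at hu1
    linarith
  have hs2 : 0 < 1 - s := by linarith
  refine ⟨?_, δ * (1 - s), by positivity, fun y hy hyd => ?_⟩
  · simp only [PiLp.add_apply, PiLp.smul_apply, smul_eq_mul, Finset.sum_add_distrib,
      ← Finset.mul_sum, hus, hx1]
    ring
  · set z : EuclideanSpace ℝ (Fin (n + 1)) := x + (1 - s)⁻¹ • (y - (x + s • u)) with hz
    have hzC : z ∈ C := by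
      apply h
      · simp only [hz, PiLp.add_apply, PiLp.smul_apply, PiLp.sub_apply, smul_eq_mul,
          Finset.sum_add_distrib, Finset.sum_sub_distrib, ← Finset.mul_sum, hus, hx1, hy]
        ring
      · rw [dist_eq_norm] at hyd ⊢
        rw [hz, add_sub_cancel_left, norm_smul, Real.norm_of_nonneg (by positivity),
          inv_mul_lt_iff₀ hs2, mul_comm]
        exact hyd
    have := hCc hzC hu (a := 1 - s) (b := s) hs2.le hs0 (by ring)
    convert this using 1
    rw [hz, smul_add (1 - s), smul_smul, mul_inv_cancel₀ hs2.ne']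
    module

theorem finsler_le {C D : Set (EuclideanSpace ℝ (Fin (n + 1)))} (hCc : Convex ℝ C)
    (hDc : Convex ℝ D) (hC : ∀ x, x ∈ affineSpan ℝ C ↔ ∑ i, x i = 1)
    (hD : ∀ x, x ∈ affineSpan ℝ D ↔ ∑ i, x i = 1) (hCb : Bornology.IsBounded C)
    (hDb : Bornology.IsBounded D) {x v : EuclideanSpace ℝ (Fin (n + 1))} (hv : ∑ i, v i = 0)
    (hxC : x ∈ intrinsicInterior ℝ C) (hxD : x ∈ intrinsicInterior ℝ D) {c : ℝ} (hc : 0 < c)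
    (h : ∀ u : EuclideanSpace ℝ (Fin (n + 1)), ∑ i, u i = 0 → x + u ∈ C → x - u ∈ C →
      x + c • u ∈ D ∧ x - c • u ∈ D) :
    finslerNorm (intrinsicInterior ℝ D) x v ≤ 4 / c * finslerNorm (intrinsicInterior ℝ C) x v := by
  unfold finslerNorm
  by_cases hv0 : v = 0
  · simp [hv0]
  rw [if_neg hv0, if_neg hv0]
  have hvn : 0 < ‖v‖ := norm_pos_iff.2 hv0
  obtain ⟨R, hR⟩ := (hCb.union hDb).exists_norm_le
  have hbd : ∀ t : ℝ, x + t • v ∈ C ∪ D → |t| ≤ (R + ‖x‖) / ‖v‖ := by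
    intro t ht
    rw [le_div_iff₀ hvn]
    have h1 : t • v = (x + t • v) - x := by abel
    calc |t| * ‖v‖ = ‖t • v‖ := by rw [norm_smul, Real.norm_eq_abs]
      _ = ‖(x + t • v) - x‖ := by rw [← h1]
      _ ≤ ‖x + t • v‖ + ‖x‖ := norm_sub_le _ _
      _ ≤ R + ‖x‖ := by gcongr; exact hR _ ht
  have e : 4 / c = 2 / (c / 2) := by field_simp; norm_num
  rw [e]
  refine chord_compare (R := (R + ‖x‖) / ‖v‖) (by positivity) ?_ ?_ ?_ ?_ ?_
  · have hx := (mem_ri_iff hC x).1 hxC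
    obtain ⟨hx1, δ, hδ, hx⟩ := hx
    refine ⟨δ / ‖v‖ / 2, by positivity, fun t ht => ?_⟩
    have h2 : x + (2 * t) • v ∈ C := by
      apply hx
      · simp only [PiLp.add_apply, PiLp.smul_apply, smul_eq_mul, Finset.sum_add_distrib,
          ← Finset.mul_sum, hv, hx1]
        ring
      · rw [dist_eq_norm, add_sub_cancel_left, norm_smul, Real.norm_eq_abs, abs_mul,
          ← lt_div_iff₀ hvn, abs_two]
        linarith
    have := ri_star hCc hC hxC h2 (s := 1 / 2) (by norm_num) (by norm_num)
    rw [smul_smul] at this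
    have e : (1 / 2 : ℝ) * (2 * t) = t := by ring
    rw [e] at this
    exact this
  · intro t ht r hr0 hr1
    rcases hr1.eq_or_lt with rfl | hr1
    · simpa using ht
    · have := ri_star hCc hC hxC (intrinsicInterior_subset ht) hr0 hr1
      rw [smul_smul] at this
      exact this
  · exact fun t ht => hbd t (Or.inl (intrinsicInterior_subset ht))
  · exact fun t ht => hbd t (Or.inr (intrinsicInterior_subset ht))
  · intro s hs h1 h2
    have h1' : x + s • v ∈ C := intrinsicInterior_subset h1
    have h2' : x - s • v ∈ C := by
      have : x + (-s) • v ∈ C := intrinsicInterior_subset h2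
      rwa [neg_smul, ← sub_eq_add_neg] at this
    obtain ⟨h3, h4⟩ := h (s • v) (by
      simp only [PiLp.smul_apply, smul_eq_mul, ← Finset.mul_sum, hv, mul_zero]) h1' h2'
    constructor
    · have := ri_star hDc hD hxD h3 (s := 1 / 2) (by norm_num) (by norm_num)
      rw [smul_smul, smul_smul] at this
      have e : (1 / 2 : ℝ) * (c * s) = c / 2 * s := by ring
      rw [show (1 / 2 : ℝ) * c * s = c / 2 * s by ring] at this
      exact this
    · rw [sub_eq_add_neg] at h4
      have := ri_star hDc hD hxD h4 (s := 1 / 2) (by norm_num) (by norm_num)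
      rw [smul_smul, ← neg_smul, smul_smul] at this
      have e : (1 / 2 : ℝ) * (-(c * s)) = -(c / 2 * s) := by ring
      rw [e] at this
      exact this

end Finsler

section Combinatorics

variable {n : ℕ}

theorem exists_weights {ι E : Type*} [Fintype ι] [AddCommGroup E] [Module ℝ E] (v : ι → E) {x : E}
    (hx : x ∈ convexHull ℝ (Set.range v)) :
    ∃ w : ι → ℝ, (∀ i, 0 ≤ w i) ∧ ∑ i, w i = 1 ∧ x = ∑ i, w i • v i := by
  have : convexHull ℝ (Set.range v) ⊆
      {x | ∃ w : ι → ℝ, (∀ i, 0 ≤ w i) ∧ ∑ i, w i = 1 ∧ x = ∑ i, w i • v i} := by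
    classical
    apply convexHull_min
    · rintro _ ⟨i, rfl⟩
      refine ⟨Pi.single i 1, fun j => ?_, by simp, ?_⟩
      · by_cases h : j = i
        · subst h; simp
        · simp [h]
      · rw [Finset.sum_eq_single i]
        · simp
        · intro j _ h
          simp [h]
        · simp
    · rintro x ⟨w, hw0, hw1, rfl⟩ y ⟨w', hw0', hw1', rfl⟩ a b ha hb hab
      refine ⟨fun i => a * w i + b * w' i, fun i => ?_, ?_, ?_⟩
      · have := hw0 i
        have := hw0' i
        positivity
      · rw [Finset.sum_add_distrib, ← Finset.mul_sum, ← Finset.mul_sum, hw1, hw1']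
        simpa using hab
      · rw [Finset.smul_sum, Finset.smul_sum, ← Finset.sum_add_distrib]
        refine Finset.sum_congr rfl fun i _ => ?_
        rw [add_smul, smul_smul, smul_smul]
  exact this hx

theorem exists_uniform_pos {ι : Type*} [Fintype ι] (g : ι → ℝ) (hg : ∀ i, 0 < g i) :
    ∃ ε : ℝ, 0 < ε ∧ ∀ i, ε ≤ g i := by
  cases isEmpty_or_nonempty ι
  · exact ⟨1, one_pos, fun i => isEmptyElim i⟩
  · obtain ⟨i, hi⟩ := Finite.exists_min g
    exact ⟨g i, hg i, hi⟩

theorem mem_stdSimplex_iff (x : EuclideanSpace ℝ (Fin (n + 1))) :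
    x ∈ convexHull ℝ (Set.range fun i : Fin (n + 1) => EuclideanSpace.single i (1 : ℝ)) ↔
      (∀ i, 0 ≤ x i) ∧ ∑ i, x i = 1 := by
  constructor
  · intro h
    obtain ⟨w, hw0, hw1, rfl⟩ := exists_weights _ h
    have : ∀ j, (∑ i, w i • EuclideanSpace.single i (1 : ℝ) :
        EuclideanSpace ℝ (Fin (n + 1))) j = w j := by
      intro j
      simp [Finset.sum_apply, Pi.single_apply]
    simp only [this]
    exact ⟨hw0, hw1⟩
  · rintro ⟨h0, h1⟩
    have e : x = ∑ i, x i • EuclideanSpace.single i (1 : ℝ) := by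
      ext j
      simp [Finset.sum_apply, Pi.single_apply]
    rw [e]
    exact (convex_convexHull ℝ _).sum_mem (fun i _ => h0 i) h1
      (fun i _ => subset_convexHull ℝ _ ⟨i, rfl⟩)

variable {vhat : Fin (n + 1) → EuclideanSpace ℝ (Fin (n + 1))}

theorem single_succ_eq (hvhat : ∀ (k : Fin (n + 1)) (i : Fin (n + 1)),
      vhat k i = if (i : ℕ) ≤ (k : ℕ) then (((k : ℕ) : ℝ) + 1)⁻¹ else 0)
    (i j : Fin (n + 1)) (hij : (j : ℕ) + 1 = i) :
    EuclideanSpace.single i (1 : ℝ) = ((i : ℕ) + 1 : ℝ) • vhat i - ((i : ℕ) : ℝ) • vhat j := by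
  ext l
  have h1 : ((i : ℕ) : ℝ) + 1 ≠ 0 := by positivity
  have h2 : ((j : ℕ) : ℝ) + 1 = ((i : ℕ) : ℝ) := by exact_mod_cast hij
  have h3 : ((i : ℕ) : ℝ) ≠ 0 := by rw [← h2]; positivity
  simp only [PiLp.sub_apply, PiLp.smul_apply, smul_eq_mul, hvhat, h2, PiLp.single_apply]
  by_cases hl : l = i
  · subst hl
    rw [if_pos rfl, if_pos le_rfl, if_neg (by omega), mul_inv_cancel₀ h1]
    simp
  · have hl' : (l : ℕ) ≠ i := fun h => hl (Fin.ext h)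
    rw [if_neg hl]
    by_cases hlt : (l : ℕ) ≤ j
    · rw [if_pos hlt, if_pos (by omega), mul_inv_cancel₀ h1, mul_inv_cancel₀ h3]
      simp
    · rw [if_neg hlt, if_neg (by omega)]
      simp

theorem single_zero_eq (hvhat : ∀ (k : Fin (n + 1)) (i : Fin (n + 1)),
      vhat k i = if (i : ℕ) ≤ (k : ℕ) then (((k : ℕ) : ℝ) + 1)⁻¹ else 0)
    (i : Fin (n + 1)) (hi : (i : ℕ) = 0) :
    EuclideanSpace.single i (1 : ℝ) = vhat i := by
  ext l
  simp only [hvhat, hi, PiLp.single_apply]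
  by_cases hl : l = i
  · subst hl
    simp [hi]
  · have hl' : (l : ℕ) ≠ i := fun h => hl (Fin.ext h)
    rw [if_neg hl, if_neg (by omega)]

theorem vhat_linearIndependent (hvhat : ∀ (k : Fin (n + 1)) (i : Fin (n + 1)),
      vhat k i = if (i : ℕ) ≤ (k : ℕ) then (((k : ℕ) : ℝ) + 1)⁻¹ else 0) :
    LinearIndependent ℝ vhat := by
  apply linearIndependent_of_top_le_span_of_card_eq_finrank
  · have hs : ∀ i : Fin (n + 1), EuclideanSpace.single i (1 : ℝ) ∈
        Submodule.span ℝ (Set.range vhat) := by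
      intro i
      by_cases hi : (i : ℕ) = 0
      · rw [single_zero_eq hvhat i hi]
        exact Submodule.subset_span ⟨i, rfl⟩
      · rw [single_succ_eq hvhat i ⟨(i : ℕ) - 1, by omega⟩ (by simp only; omega)]
        exact Submodule.sub_mem _ (Submodule.smul_mem _ _ (Submodule.subset_span ⟨_, rfl⟩))
          (Submodule.smul_mem _ _ (Submodule.subset_span ⟨_, rfl⟩))
    intro x _
    have e : x = ∑ i, x i • EuclideanSpace.single i (1 : ℝ) := by
      ext j
      simp [Finset.sum_apply, Pi.single_apply]
    rw [e]
    exact Submodule.sum_mem _ fun i _ => Submodule.smul_mem _ _ (hs i)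
  · simp

theorem vhat_inCone (hvhat : ∀ (k : Fin (n + 1)) (i : Fin (n + 1)),
      vhat k i = if (i : ℕ) ≤ (k : ℕ) then (((k : ℕ) : ℝ) + 1)⁻¹ else 0)
    {P : Set (EuclideanSpace ℝ (Fin (n + 1)))} (hP : Convex ℝ P) (hmem : ∀ k, vhat k ∈ P)
    (hF : ∀ i k : Fin (n + 1), i ≤ k → InCone P (vhat k) (vhat k - vhat i))
    (i k : Fin (n + 1)) (hik : i ≤ k) :
    InCone P (vhat k) (EuclideanSpace.single i (1 : ℝ) - vhat k) ∧
      InCone P (vhat k) (vhat k - EuclideanSpace.single i (1 : ℝ)) := by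
  by_cases hi : (i : ℕ) = 0
  · rw [single_zero_eq hvhat i hi]
    exact ⟨InCone.sub_mem (hmem i), hF i k hik⟩
  · set j : Fin (n + 1) := ⟨(i : ℕ) - 1, by omega⟩ with hj
    have hjk : j ≤ k := by
      rw [Fin.le_def] at hik ⊢
      simp only [hj]
      omega
    rw [single_succ_eq hvhat i j (by simp only [hj]; omega)]
    have p1 : (0 : ℝ) ≤ (i : ℕ) + 1 := by positivity
    have p2 : (0 : ℝ) ≤ (i : ℕ) := by positivity
    constructor
    · have := ((InCone.sub_mem (q := vhat k) (hmem i)).smul (hmem k) p1).add hP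
        ((hF j k hjk).smul (hmem k) p2)
      convert this using 1
      module
    · have := ((hF i k hik).smul (hmem k) p1).add hP
        ((InCone.sub_mem (q := vhat k) (hmem j)).smul (hmem k) p2)
      convert this using 1
      module

theorem vhat_perturb (hvhat : ∀ (k : Fin (n + 1)) (i : Fin (n + 1)),
      vhat k i = if (i : ℕ) ≤ (k : ℕ) then (((k : ℕ) : ℝ) + 1)⁻¹ else 0)
    {P : Set (EuclideanSpace ℝ (Fin (n + 1)))} (hP : Convex ℝ P) (hmem : ∀ k, vhat k ∈ P)
    (hF : ∀ i k : Fin (n + 1), i ≤ k → InCone P (vhat k) (vhat k - vhat i)) :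
    ∃ ε : ℝ, 0 < ε ∧ ∀ (k : Fin (n + 1)) (a : Fin (n + 1) → ℝ), (∀ i, ¬ i ≤ k → a i = 0) →
      ∑ i, |a i| ≤ ε →
      vhat k + ∑ i, a i • (EuclideanSpace.single i (1 : ℝ) - vhat k) ∈ P := by
  have h1 : ∀ p : Fin (n + 1) × Fin (n + 1), ∃ ε : ℝ, 0 < ε ∧ (p.1 ≤ p.2 →
      vhat p.2 + ε • (EuclideanSpace.single p.1 (1 : ℝ) - vhat p.2) ∈ P ∧
      vhat p.2 + ε • (vhat p.2 - EuclideanSpace.single p.1 (1 : ℝ)) ∈ P) := by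
    rintro ⟨i, k⟩
    by_cases hik : i ≤ k
    · obtain ⟨⟨a, ha, h⟩, ⟨b, hb, h'⟩⟩ := vhat_inCone hvhat hP hmem hF i k hik
      refine ⟨min a b, lt_min ha hb, fun _ => ⟨?_, ?_⟩⟩
      · exact InCone.mem_le hP (hmem k) (lt_min ha hb).le (min_le_left _ _) h
      · exact InCone.mem_le hP (hmem k) (lt_min ha hb).le (min_le_right _ _) h'
    · exact ⟨1, one_pos, fun h => absurd h hik⟩
  choose g hg0 hg using h1
  obtain ⟨ε, hε, hεg⟩ := exists_uniform_pos g hg0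
  refine ⟨ε, hε, fun k a ha hsum => ?_⟩
  have hz : ∀ i, ∃ z ∈ P, (|a i| / ε) • (z - vhat k) =
      a i • (EuclideanSpace.single i (1 : ℝ) - vhat k) := by
    intro i
    by_cases hik : i ≤ k
    · have hgi := hg (i, k) hik
      rcases le_total 0 (a i) with h0 | h0
      · refine ⟨_, InCone.mem_le hP (hmem k) hε.le (hεg (i, k)) hgi.1, ?_⟩
        rw [add_sub_cancel_left, smul_smul, abs_of_nonneg h0, div_mul_cancel₀ _ hε.ne']
      · refine ⟨_, InCone.mem_le hP (hmem k) hε.le (hεg (i, k)) hgi.2, ?_⟩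
        rw [add_sub_cancel_left, smul_smul, abs_of_nonpos h0, div_mul_cancel₀ _ hε.ne']
        simp only
        module
    · refine ⟨vhat k, hmem k, ?_⟩
      rw [ha i hik]
      simp
  choose z hzP hz using hz
  have key := hP.sum_mem (t := Finset.univ) (w := fun o : Option (Fin (n + 1)) =>
      o.elim (1 - ∑ i, |a i| / ε) (fun i => |a i| / ε))
    (z := fun o : Option (Fin (n + 1)) => o.elim (vhat k) z) ?_ ?_ ?_
  · rw [Fintype.sum_option] at key
    simp only [Option.elim] at key
    convert key using 1
    simp_rw [← hz, smul_sub]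
    rw [Finset.sum_sub_distrib, sub_smul, ← Finset.sum_smul, one_smul]
    abel
  · rintro (_ | i) _
    · simp only [Option.elim]
      rw [← Finset.sum_div, sub_nonneg, div_le_one hε]
      exact hsum
    · simp only [Option.elim]
      positivity
  · rw [Fintype.sum_option]
    simp
  · rintro (_ | i) _
    · exact hmem k
    · exact hzP i

/-- The inclusion of the symmetrized simplex, up to a constant, in the polytope. -/
theorem simplex_to_polytope (hvhat : ∀ (k : Fin (n + 1)) (i : Fin (n + 1)),
      vhat k i = if (i : ℕ) ≤ (k : ℕ) then (((k : ℕ) : ℝ) + 1)⁻¹ else 0)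
    {P : Set (EuclideanSpace ℝ (Fin (n + 1)))} (hP : Convex ℝ P) (hmem : ∀ k, vhat k ∈ P)
    (hF : ∀ i k : Fin (n + 1), i ≤ k → InCone P (vhat k) (vhat k - vhat i)) :
    ∃ c : ℝ, 0 < c ∧ ∀ x ∈ convexHull ℝ (Set.range vhat), ∀ u : EuclideanSpace ℝ (Fin (n + 1)),
      ∑ i, u i = 0 → (∀ i, |u i| ≤ x i) → x + c • u ∈ P := by
  obtain ⟨ε, hε, hpert⟩ := vhat_perturb hvhat hP hmem hF
  have hv0 : ∀ k i, 0 ≤ vhat k i := by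
    intro k i
    rw [hvhat]
    split_ifs
    · positivity
    · exact le_rfl
  have hvs : ∀ k, ∑ i, vhat k i = 1 := by
    intro k
    simp only [hvhat]
    rw [← Finset.sum_filter, Finset.sum_const]
    have : (Finset.univ.filter (fun i : Fin (n + 1) => (i : ℕ) ≤ k)) = Finset.Iic k := by
      ext i
      rw [Finset.mem_filter, Finset.mem_Iic, Fin.le_def]
      exact ⟨fun h => h.2, fun h => ⟨Finset.mem_univ _, h⟩⟩
    rw [this, Fin.card_Iic, nsmul_eq_mul]
    push_cast
    exact mul_inv_cancel₀ (by positivity)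
  set c := min (1 / 2) (ε / 2) with hc
  have hc0 : 0 < c := lt_min (by norm_num) (by positivity)
  have hc1 : c ≤ 1 / 2 := min_le_left _ _
  have hc2 : c ≤ ε / 2 := min_le_right _ _
  refine ⟨c, hc0, fun x hx u hu hux => ?_⟩
  obtain ⟨w, hw0, hw1, hxw⟩ := exists_weights _ hx
  have hxi : ∀ i, x i = ∑ k, w k * vhat k i := by
    intro i
    rw [hxw]
    simp [Finset.sum_apply]
  set U : Fin (n + 1) → Fin (n + 1) → ℝ := fun k i => vhat k i * (u i / x i) with hU
  have hUle : ∀ k i, |U k i| ≤ vhat k i := by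
    intro k i
    simp only [hU]
    rw [abs_mul, abs_of_nonneg (hv0 k i)]
    have : |u i / x i| ≤ 1 := by
      have hx0 : 0 ≤ x i := (abs_nonneg _).trans (hux i)
      rw [abs_div, abs_of_nonneg hx0]
      exact div_le_one_of_le₀ (hux i) hx0
    exact mul_le_of_le_one_right (hv0 k i) this
  have hUs : ∀ i, ∑ k, w k * U k i = u i := by
    intro i
    have : ∑ k, w k * U k i = x i * (u i / x i) := by
      rw [hxi i, Finset.sum_mul]
      refine Finset.sum_congr rfl fun k _ => ?_
      simp only [hU]
      rw [hxi i]
      ring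
    rw [this]
    by_cases h0 : x i = 0
    · have := hux i
      rw [h0] at this
      have := abs_nonpos_iff.1 this
      rw [this]
      simp
    · field_simp
  set s : Fin (n + 1) → ℝ := fun k => ∑ i, U k i with hs
  have hsle : ∀ k, |s k| ≤ 1 := by
    intro k
    calc |s k| ≤ ∑ i, |U k i| := Finset.abs_sum_le_sum_abs _ _
      _ ≤ ∑ i, vhat k i := Finset.sum_le_sum fun i _ => hUle k i
      _ = 1 := hvs k
  have hpos : ∀ k, 1 / 2 ≤ 1 + c * s k := by
    intro k
    have := (abs_le.1 (hsle k)).1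
    nlinarith
  have hws : ∑ k, w k * s k = 0 := by
    simp only [hs, Finset.mul_sum]
    rw [Finset.sum_comm]
    simp only [hUs, hu]
  set z : Fin (n + 1) → EuclideanSpace ℝ (Fin (n + 1)) := fun k =>
    vhat k + ∑ i, (c * U k i / (1 + c * s k)) • (EuclideanSpace.single i (1 : ℝ) - vhat k) with hz
  have hzP : ∀ k, z k ∈ P := by
    intro k
    apply hpert
    · intro i hik
      have : vhat k i = 0 := by
        rw [hvhat, if_neg]
        exact fun h => hik (Fin.le_def.2 h)
      simp [hU, this]
    · have hp : 0 < 1 + c * s k := by linarith [hpos k]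
      calc ∑ i, |c * U k i / (1 + c * s k)| ≤ ∑ i, 2 * c * vhat k i := by
            refine Finset.sum_le_sum fun i _ => ?_
            rw [abs_div, abs_mul, abs_of_pos hc0, abs_of_pos hp, div_le_iff₀ hp]
            have h1 := hUle k i
            have h2 := hpos k
            have h3 := hv0 k i
            have h4 : c * |U k i| ≤ c * vhat k i := mul_le_mul_of_nonneg_left h1 hc0.le
            have h5 : 0 ≤ c * vhat k i := by positivity
            nlinarith
        _ = 2 * c := by rw [← Finset.mul_sum, hvs, mul_one]
        _ ≤ ε := by linarith
  have hfin : x + c • u = ∑ k, (w k * (1 + c * s k)) • z k := by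
    ext j
    have hzj : ∀ k, (1 + c * s k) * z k j =
        (1 + c * s k) * vhat k j + c * (U k j - s k * vhat k j) := by
      intro k
      have hp : 1 + c * s k ≠ 0 := by linarith [hpos k]
      have : (∑ i, (c * U k i / (1 + c * s k)) • (EuclideanSpace.single i (1 : ℝ) - vhat k) :
          EuclideanSpace ℝ (Fin (n + 1))) j =
          c / (1 + c * s k) * (U k j - s k * vhat k j) := by
        simp only [WithLp.ofLp_sum, Finset.sum_apply, PiLp.smul_apply, PiLp.sub_apply, smul_eq_mul,
          mul_sub, Finset.sum_sub_distrib, PiLp.single_apply]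
        simp only [mul_ite, mul_one, mul_zero, Finset.sum_ite_eq, Finset.mem_univ, if_true]
        rw [← Finset.sum_mul, ← Finset.sum_div, ← Finset.mul_sum]
        simp only [hs]
        ring
      simp only [hz, PiLp.add_apply]
      rw [this]
      field_simp
    simp only [PiLp.add_apply, PiLp.smul_apply, smul_eq_mul, WithLp.ofLp_sum, Finset.sum_apply]
    rw [hxi j, ← hUs j, Finset.mul_sum, ← Finset.sum_add_distrib]
    refine Finset.sum_congr rfl fun k _ => ?_
    rw [mul_assoc, hzj k]
    ring
  rw [hfin]
  refine hP.sum_mem (fun k _ => mul_nonneg (hw0 k) (by linarith [hpos k])) ?_ fun k _ => hzP k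
  have : ∀ k, w k * (1 + c * s k) = w k + c * (w k * s k) := fun k => by ring
  simp only [this, Finset.sum_add_distrib, ← Finset.mul_sum, hw1, hws]
  ring

/-- The inclusion of the symmetrized polytope, up to a constant, in the simplex. -/
theorem polytope_to_simplex (hvhat : ∀ (k : Fin (n + 1)) (i : Fin (n + 1)),
      vhat k i = if (i : ℕ) ≤ (k : ℕ) then (((k : ℕ) : ℝ) + 1)⁻¹ else 0)
    {P : Set (EuclideanSpace ℝ (Fin (n + 1)))} (m : Fin (n + 1))
    (l : EuclideanSpace ℝ (Fin (n + 1)) →ᵃ[ℝ] ℝ) {K : ℝ} (hK : 0 ≤ K)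
    (hl0 : ∀ p ∈ P, 0 ≤ l p) (hlK : ∀ p ∈ P, |p m| ≤ K * l p)
    (hlv : ∀ k, k < m → l (vhat k) = 0) :
    ∃ K' : ℝ, 0 ≤ K' ∧ ∀ x ∈ convexHull ℝ (Set.range vhat),
      ∀ u : EuclideanSpace ℝ (Fin (n + 1)), x + u ∈ P → x - u ∈ P → |u m| ≤ K' * x m := by
  set A : ℝ := (∑ k, |l (vhat k)|) * (n + 1) with hA
  have hA0 : 0 ≤ A := by positivity
  have hsub : convexHull ℝ (Set.range vhat) ⊆ {x | l x ≤ A * x m ∧ 0 ≤ x m} := by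
    apply convexHull_min
    · rintro _ ⟨k, rfl⟩
      have hm0 : 0 ≤ vhat k m := by
        rw [hvhat]
        split_ifs
        · positivity
        · exact le_rfl
      refine ⟨?_, hm0⟩
      by_cases hkm : k < m
      · rw [hlv k hkm]
        positivity
      · have hle : (m : ℕ) ≤ k := by
          rw [Fin.lt_def] at hkm
          omega
        rw [hvhat, if_pos hle]
        have h1 : l (vhat k) ≤ ∑ k, |l (vhat k)| :=
          (le_abs_self _).trans (Finset.single_le_sum (f := fun k => |l (vhat k)|)
            (fun i _ => abs_nonneg _) (Finset.mem_univ k))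
        have hk : ((k : ℕ) : ℝ) + 1 ≤ n + 1 := by
          have : (k : ℕ) ≤ n := by omega
          have : ((k : ℕ) : ℝ) ≤ n := by exact_mod_cast this
          linarith
        have hkp : (0 : ℝ) < ((k : ℕ) : ℝ) + 1 := by positivity
        rw [← div_eq_mul_inv, le_div_iff₀ hkp, hA]
        have h0 : 0 ≤ ∑ k, |l (vhat k)| := Finset.sum_nonneg fun i _ => abs_nonneg _
        calc l (vhat k) * (((k : ℕ) : ℝ) + 1) ≤ (∑ k, |l (vhat k)|) * (((k : ℕ) : ℝ) + 1) := by
              gcongr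
          _ ≤ _ := by gcongr
    · rintro x ⟨hx, hx0⟩ y ⟨hy, hy0⟩ a b ha hb hab
      refine ⟨?_, ?_⟩
      · rw [Convex.combo_affine_apply hab]
        simp only [smul_eq_mul, PiLp.add_apply, PiLp.smul_apply]
        nlinarith [mul_le_mul_of_nonneg_left hx ha, mul_le_mul_of_nonneg_left hy hb]
      · simp only [smul_eq_mul, PiLp.add_apply, PiLp.smul_apply]
        positivity
  refine ⟨2 * K * A + 1, by positivity, fun x hx u h1 h2 => ?_⟩
  obtain ⟨hx1, hx0⟩ := hsub hx
  have hmid : l x = 1 / 2 * l (x + u) + 1 / 2 * l (x - u) := by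
    have := Convex.combo_affine_apply (f := l) (x := x + u) (y := x - u)
      (show (1 / 2 : ℝ) + 1 / 2 = 1 by norm_num)
    have e : (1 / 2 : ℝ) • (x + u) + (1 / 2 : ℝ) • (x - u) = x := by module
    rw [e] at this
    simpa using this
  have h3 : l (x + u) ≤ 2 * l x := by linarith [hl0 _ h2]
  have h4 := hlK _ h1
  simp only [PiLp.add_apply] at h4
  have h5 : |u m| ≤ |x m + u m| + |x m| := by
    have := abs_sub (x m + u m) (x m)
    rwa [add_sub_cancel_left] at this
  rw [abs_of_nonneg hx0] at h5
  have h6 : K * l (x + u) ≤ K * (2 * (A * x m)) := mul_le_mul_of_nonneg_left (by linarith) hK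
  nlinarith

end Combinatorics

section CellFacts

theorem cellPts_facts {n : ℕ} (hn : 0 < n)
    (V : Finset (EuclideanSpace ℝ (Fin n))) (P : Set (EuclideanSpace ℝ (Fin n)))
    (hP : P = convexHull ℝ (V : Set (EuclideanSpace ℝ (Fin n))))
    (hdim : (interior P).Nonempty)
    (hbar : centroid n P = 0)
    (f : Fin n → Set (EuclideanSpace ℝ (Fin n))) (hf : IsCompleteFlag P f)
    (L : EuclideanSpace ℝ (Fin n) →ᵃ[ℝ] EuclideanSpace ℝ (Fin (n + 1)))
    (vhat : Fin (n + 1) → EuclideanSpace ℝ (Fin (n + 1)))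
    (hvhat : ∀ (k : Fin (n + 1)) (i : Fin (n + 1)),
      vhat k i = if (i : ℕ) ≤ (k : ℕ) then (((k : ℕ) : ℝ) + 1)⁻¹ else 0)
    (hL : ∀ k : Fin (n + 1), L (cellPts P f k) = vhat k) :
    (∀ k, cellPts P f k ∈ P) ∧
    (∀ i k : Fin (n + 1), i ≤ k → InCone P (cellPts P f k) (cellPts P f k - cellPts P f i)) ∧
    ∀ m : Fin (n + 1), ∃ (l : EuclideanSpace ℝ (Fin n) →ᵃ[ℝ] ℝ) (K : ℝ), 0 ≤ K ∧
      (∀ p ∈ P, 0 ≤ l p) ∧ (∀ p ∈ P, |L p m| ≤ K * l p) ∧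
      ∀ k, k < m → l (cellPts P f k) = 0 := by
  have hPc : Convex ℝ P := hP ▸ convex_convexHull ℝ _
  have hPcomp : IsCompact P := hP ▸ polytope_isCompact V
  have hli := vhat_linearIndependent hvhat
  have hlast : ∀ k : Fin (n + 1), ¬ (k : ℕ) < n → cellPts P f k = centroid n P := by
    intro k hk
    unfold cellPts
    rw [dif_neg hk]
  have hface : ∀ (k : Fin (n + 1)) (h : (k : ℕ) < n), cellPts P f k ∈ f ⟨k, h⟩ := by
    intro k h
    have e : cellPts P f k = centroid (k : ℕ) (f ⟨k, h⟩) := by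
      unfold cellPts
      rw [dif_pos h]
    rw [e]
    refine centroid_mem_face V (hP ▸ (hf.1 ⟨k, h⟩).1) ?_
    intro h0
    have e0 : cellPts P f k = 0 := by
      rw [e, centroid, h0]
      simp
    have e1 : cellPts P f (Fin.last n) = 0 := by
      rw [hlast _ (by simp), hbar]
    have : vhat k = vhat (Fin.last n) := by
      rw [← hL, ← hL, e0, e1]
    have := hli.injective this
    rw [this] at h
    simp at h
  have hcl : ∀ i j : ℕ, i ≤ j → ∀ (hi : i < n) (hj : j < n),
      closure (f ⟨i, hi⟩) ⊆ closure (f ⟨j, hj⟩) := by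
    intro i j hij
    induction j, hij using Nat.le_induction with
    | base => intro hi hj; exact subset_rfl
    | succ j hij ih =>
      intro hi hj
      exact (ih hi (by omega)).trans (hf.2 j hj).subset
  have hmemcl : ∀ (i k : Fin (n + 1)) (_ : i ≤ k) (hk : (k : ℕ) < n),
      cellPts P f i ∈ closure (f ⟨k, hk⟩) := by
    intro i k hik hk
    have hi : (i : ℕ) < n := lt_of_le_of_lt hik hk
    exact hcl i k hik hi hk (subset_closure (hface i hi))
  have hcen := inCone_centroid_polytope V (hP ▸ hdim)
  rw [← hP] at hcen
  have hmem : ∀ k, cellPts P f k ∈ P := by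
    intro k
    by_cases hk : (k : ℕ) < n
    · exact face_subset hPc (hf.1 ⟨k, hk⟩).1 (hface k hk)
    · rw [hlast k hk]
      exact hcen.1
  have hcone : ∀ i k : Fin (n + 1), i ≤ k →
      InCone P (cellPts P f k) (cellPts P f k - cellPts P f i) := by
    intro i k hik
    by_cases hk : (k : ℕ) < n
    · have := inCone_of_mem_closure_face V (hP ▸ (hf.1 ⟨k, hk⟩).1) (hface k hk) (hmemcl i k hik hk)
      rwa [← hP] at this
    · rw [hlast k hk]
      exact hcen.2 _ (hmem i)
  refine ⟨hmem, hcone, fun m => ?_⟩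
  by_cases hm : (m : ℕ) = 0
  · have hLc : Continuous L := L.continuous_of_finiteDimensional
    obtain ⟨R, hR⟩ := (hPcomp.image hLc).isBounded.exists_norm_le
    refine ⟨AffineMap.const ℝ _ 1, max R 0, le_max_right _ _, fun p _ => by simp, ?_, ?_⟩
    · intro p hp
      have h1 := hR _ ⟨p, hp, rfl⟩
      have h2 := PiLp.norm_apply_le (L p) m
      rw [Real.norm_eq_abs] at h2
      simp only [AffineMap.const_apply, mul_one]
      exact (h2.trans h1).trans (le_max_left _ _)
    · intro k hk
      rw [Fin.lt_def] at hk
      omega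
  · -- the face spanned by the first `m` vertices
    set j : Fin (n + 1) := ⟨(m : ℕ) - 1, by omega⟩ with hj
    have hjn : (j : ℕ) < n := by
      simp only [hj]
      omega
    set q := cellPts P f j with hq
    obtain ⟨l0, hl1, hl2⟩ := exists_exposing V q (hP ▸ hmem j)
    rw [← hP] at hl1 hl2
    have hlzero : ∀ k, k < m → l0 (cellPts P f k) = l0 q := by
      intro k hk
      have hkj : k ≤ j := by
        rw [Fin.lt_def] at hk
        rw [Fin.le_def]
        simp only [hj]
        omega
      obtain ⟨ε, hε, h⟩ := hcone k j hkj
      have h1 := hl1 _ h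
      have h2 := hl1 _ (hmem k)
      rw [map_add, map_smul, map_sub, smul_eq_mul, ← hq] at h1
      nlinarith
    -- the coordinate vanishes on the span of the face
    set F := f ⟨j, hjn⟩ with hF
    have hspan : ∀ w ∈ affineSpan ℝ F, L w m = 0 := by
      set pts : Fin (m : ℕ) → EuclideanSpace ℝ (Fin n) :=
        fun i => cellPts P f ⟨i, by omega⟩ with hpts
      have hind : AffineIndependent ℝ pts := by
        apply AffineIndependent.of_comp L
        have e : L ∘ pts = fun i : Fin (m : ℕ) => vhat ⟨i, by omega⟩ := by
          funext i
          simp only [hpts, Function.comp, hL]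
        rw [e]
        have := hli.affineIndependent
        refine this.comp_embedding ⟨fun i : Fin (m : ℕ) => (⟨i, by omega⟩ : Fin (n + 1)), ?_⟩
        intro a b hab
        have := congrArg Fin.val hab
        exact Fin.ext this
      have hsub : affineSpan ℝ (Set.range pts) ≤ affineSpan ℝ F := by
        rw [affineSpan_le]
        rintro _ ⟨i, rfl⟩
        have hclF : closure F ⊆ affineSpan ℝ F :=
          closure_minimal (subset_affineSpan ℝ F) (AffineSubspace.closed_of_finiteDimensional _)
        apply hclF
        apply hmemcl _ j _ hjn
        rw [Fin.le_def]
        simp only [hj]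
        omega
      have hd : Module.finrank ℝ (affineSpan ℝ F).direction = (j : ℕ) := (hf.1 ⟨j, hjn⟩).2
      have heq := hind.affineSpan_eq_of_le_of_card_eq_finrank_add_one hsub (by
        rw [hd, Fintype.card_fin]
        simp only [hj]
        omega)
      intro w hw
      rw [← heq] at hw
      refine affineSpan_induction (p := fun w => L w m = 0) hw ?_ ?_
      · rintro _ ⟨i, rfl⟩
        simp only [hpts, hL, hvhat]
        rw [if_neg (by omega)]
      · intro c u v w hu hv hw
        have : L (c • (u -ᵥ v) +ᵥ w) = c • (L u - L v) + L w := by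
          rw [AffineMap.map_vadd, map_smul, AffineMap.linearMap_vsub]
          rfl
        rw [this]
        simp [hu, hv, hw]
    have hV0 : ∀ w ∈ V, l0 w = l0 q → L w m = 0 := by
      intro w hw h
      have hwP : w ∈ P := hP ▸ subset_convexHull ℝ _ hw
      exact hspan w (mem_affineSpan_of_inCone hPc (hf.1 ⟨j, hjn⟩).1 (hface j hjn) hwP
        (hl2 w hwP h))
    set l : EuclideanSpace ℝ (Fin n) →ᵃ[ℝ] ℝ :=
      l0.toLinearMap.toAffineMap - AffineMap.const ℝ _ (l0 q) with hl
    have hlapp : ∀ p, l p = l0 p - l0 q := fun p => rfl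
    have hlnn : ∀ p ∈ P, 0 ≤ l p := fun p hp => by
      rw [hlapp]
      linarith [hl1 p hp]
    have hVP : ∀ w ∈ V, w ∈ P := fun w hw => hP ▸ subset_convexHull ℝ _ hw
    refine ⟨l, ∑ w ∈ V, |L w m| / l w, ?_, hlnn, ?_, ?_⟩
    · exact Finset.sum_nonneg fun w hw => div_nonneg (abs_nonneg _) (hlnn w (hVP w hw))
    · set K := ∑ w ∈ V, |L w m| / l w with hK
      have hsub : P ⊆ {p | |L p m| ≤ K * l p} := by
        nth_rewrite 1 [hP]
        apply convexHull_min
        · intro w hw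
          change |L w m| ≤ K * l w
          rcases (hlnn w (hVP w hw)).eq_or_lt with h | h
          · rw [← h, hV0 w hw (by rw [hlapp] at h; linarith)]
            simp
          · rw [← div_le_iff₀ h]
            exact Finset.single_le_sum (f := fun w => |L w m| / l w)
              (fun w hw => div_nonneg (abs_nonneg _) (hlnn w (hVP w hw))) hw
        · intro x hx y hy a b ha hb hab
          have hx' : |L x m| ≤ K * l x := hx
          have hy' : |L y m| ≤ K * l y := hy
          change |L (a • x + b • y) m| ≤ K * l (a • x + b • y)
          rw [Convex.combo_affine_apply hab, Convex.combo_affine_apply hab]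
          simp only [PiLp.add_apply, PiLp.smul_apply, smul_eq_mul]
          calc |a * L x m + b * L y m| ≤ |a * L x m| + |b * L y m| := abs_add_le _ _
            _ = a * |L x m| + b * |L y m| := by
              rw [abs_mul, abs_mul, abs_of_nonneg ha, abs_of_nonneg hb]
            _ ≤ a * (K * l x) + b * (K * l y) := by gcongr
            _ = K * (a * l x + b * l y) := by ring
      exact hsub
    · intro k hk
      rw [hlapp, hlzero k hk, sub_self]

end CellFacts

/-- Let `P ⊆ ℝⁿ` be an `n`-dimensional compact convex polytope with
barycenter at the origin, `S` a cell-simplex of its barycentric cell decomposition (with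
vertices the barycenters `v 0, …, v (n-1)` of a complete flag of faces, and `v n = b(P)`),
and let `L` be an affine bijection of `ℝⁿ` onto the hyperplane `{∑ xᵢ = 1} ⊆ ℝ^{n+1}` sending
`v k` to the vertex `v̂ k` of the standard cell-simplex `Sₙ` of the standard simplex `Hₙ`;
put `P' = L(P)`. Then the Finsler metrics of `Hₙ` and of `P'` are equivalent on `Sₙ`: there
is `k ≥ 1` with `(1/k)·F_{P'}(x,v) ≤ F_{Hₙ}(x,v) ≤ k·F_{P'}(x,v)` for all `x ∈ Sₙ ∩ int P'`
and all vectors `v` tangent to the hyperplane. -/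
theorem cellSimplex_biLipschitz_standardCellSimplex {n : ℕ} (hn : 0 < n)
    (V : Finset (EuclideanSpace ℝ (Fin n))) (P : Set (EuclideanSpace ℝ (Fin n)))
    (hP : P = convexHull ℝ (V : Set (EuclideanSpace ℝ (Fin n))))
    (hdim : (interior P).Nonempty)
    (hbar : centroid n P = 0)
    (f : Fin n → Set (EuclideanSpace ℝ (Fin n))) (hf : IsCompleteFlag P f)
    (L : EuclideanSpace ℝ (Fin n) →ᵃ[ℝ] EuclideanSpace ℝ (Fin (n + 1)))
    (hLinj : Function.Injective L)
    (hLrange : Set.range L = {x : EuclideanSpace ℝ (Fin (n + 1)) | ∑ i, x i = 1})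
    (vhat : Fin (n + 1) → EuclideanSpace ℝ (Fin (n + 1)))
    (hvhat : ∀ (k : Fin (n + 1)) (i : Fin (n + 1)),
      vhat k i = if (i : ℕ) ≤ (k : ℕ) then (((k : ℕ) : ℝ) + 1)⁻¹ else 0)
    (hL : ∀ k : Fin (n + 1), L (cellPts P f k) = vhat k)
    (P' Hn Sn : Set (EuclideanSpace ℝ (Fin (n + 1))))
    (hP' : P' = L '' P)
    (hHn : Hn = convexHull ℝ
      (Set.range fun i : Fin (n + 1) => EuclideanSpace.single i (1 : ℝ)))
    (hSn : Sn = convexHull ℝ (Set.range vhat)) :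
    ∃ k : ℝ, 1 ≤ k ∧ ∀ x ∈ Sn ∩ intrinsicInterior ℝ P',
      ∀ v : EuclideanSpace ℝ (Fin (n + 1)), (∑ i, v i) = 0 →
        k⁻¹ * finslerNorm (intrinsicInterior ℝ P') x v ≤
            finslerNorm (intrinsicInterior ℝ Hn) x v ∧
          finslerNorm (intrinsicInterior ℝ Hn) x v ≤
            k * finslerNorm (intrinsicInterior ℝ P') x v := by
  have hPc : Convex ℝ P := hP ▸ convex_convexHull ℝ _
  have hPcomp : IsCompact P := hP ▸ polytope_isCompact V
  have hP'c : Convex ℝ P' := by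
    rw [hP']
    exact hPc.affine_image L
  have hLc : Continuous L := L.continuous_of_finiteDimensional
  have hP'b : Bornology.IsBounded P' := by
    rw [hP']
    exact (hPcomp.image hLc).isBounded
  obtain ⟨hmem, hcone, hexp⟩ := cellPts_facts hn V P hP hdim hbar f hf L vhat hvhat hL
  -- an affine left inverse of `L`
  obtain ⟨G, hG⟩ := LinearMap.exists_leftInverse_of_injective L.linear
    (LinearMap.ker_eq_bot.2 ((AffineMap.linear_injective_iff L).2 hLinj))
  set B : EuclideanSpace ℝ (Fin (n + 1)) →ᵃ[ℝ] EuclideanSpace ℝ (Fin n) :=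
    G.toAffineMap - AffineMap.const ℝ _ (G (L 0)) with hB
  have hBL : ∀ y, B (L y) = y := by
    intro y
    have h1 : L y = L.linear y + L 0 := by
      have := L.map_vadd 0 y
      simpa using this
    have h2 : G (L.linear y) = y := by
      have := LinearMap.congr_fun hG y
      simpa using this
    have h3 : B (L y) = G (L y) - G (L 0) := rfl
    rw [h3, h1, map_add, h2, add_sub_cancel_right]
  have hspanP : ∀ x, x ∈ affineSpan ℝ P' ↔ ∑ i, x i = 1 := by
    intro x
    rw [hP', ← AffineSubspace.map_span, affineSpan_eq_top_of_nonempty_interior (s := P) ?_,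
      AffineSubspace.mem_map]
    · have : x ∈ Set.range L ↔ ∑ i, x i = 1 := by rw [hLrange]; rfl
      rw [← this]
      simp
    · rwa [hPc.convexHull_eq]
  have hHmem : ∀ x, x ∈ Hn ↔ (∀ i, 0 ≤ x i) ∧ ∑ i, x i = 1 := by
    intro x
    rw [hHn]
    exact mem_stdSimplex_iff x
  have hHc : Convex ℝ Hn := hHn ▸ convex_convexHull ℝ _
  have hHb : Bornology.IsBounded Hn := by
    rw [hHn]
    exact ((Set.finite_range _).isCompact_convexHull (𝕜 := ℝ)).isBounded
  have hspanH : ∀ x, x ∈ affineSpan ℝ Hn ↔ ∑ i, x i = 1 := by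
    intro x
    constructor
    · intro hx
      refine affineSpan_induction (p := fun x : EuclideanSpace ℝ (Fin (n + 1)) => ∑ i, x i = 1)
        hx (fun y hy => ((hHmem y).1 hy).2) ?_
      intro c u v w hu hv hw
      simp only [vsub_eq_sub, vadd_eq_add, PiLp.add_apply, PiLp.smul_apply, PiLp.sub_apply,
        smul_eq_mul, Finset.sum_add_distrib, Finset.sum_sub_distrib, ← Finset.mul_sum, hu, hv, hw]
      ring
    · intro hx
      have h1 := affineCombination_mem_affineSpan (k := ℝ) (s := Finset.univ) (w := fun i => x i) hx
        (fun i : Fin (n + 1) => (EuclideanSpace.single i (1 : ℝ) : EuclideanSpace ℝ (Fin (n + 1))))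
      rw [Finset.univ.affineCombination_eq_linear_combination _ _ hx] at h1
      have e : x = ∑ i, x i • EuclideanSpace.single i (1 : ℝ) := by
        ext j
        simp [Finset.sum_apply, Pi.single_apply]
      rw [e, hHn]
      exact affineSpan_mono ℝ (subset_convexHull ℝ _) h1
  have hmem' : ∀ k, vhat k ∈ P' := fun k => by
    rw [hP', ← hL k]
    exact ⟨_, hmem k, rfl⟩
  have hcone' : ∀ i k : Fin (n + 1), i ≤ k → InCone P' (vhat k) (vhat k - vhat i) := by
    intro i k hik
    obtain ⟨ε, hε, h⟩ := hcone i k hik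
    refine ⟨ε, hε, ?_⟩
    rw [hP']
    refine ⟨_, h, ?_⟩
    have h1 : L (cellPts P f k + ε • (cellPts P f k - cellPts P f i)) =
        L.linear (ε • (cellPts P f k - cellPts P f i)) + L (cellPts P f k) := by
      have := L.map_vadd (cellPts P f k) (ε • (cellPts P f k - cellPts P f i))
      rw [vadd_eq_add, vadd_eq_add] at this
      rw [add_comm (cellPts P f k) (ε • (cellPts P f k - cellPts P f i)), this]
    have h2 : L.linear (cellPts P f k - cellPts P f i) = vhat k - vhat i := by
      have := L.linearMap_vsub (cellPts P f k) (cellPts P f i)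
      rw [vsub_eq_sub, vsub_eq_sub] at this
      rw [this, hL, hL]
    rw [h1, map_smul, h2, hL]
    exact add_comm _ _
  obtain ⟨c, hc, hHP⟩ := simplex_to_polytope hvhat hP'c hmem' hcone'
  have hPH : ∀ m : Fin (n + 1), ∃ K' : ℝ, 0 ≤ K' ∧ ∀ x ∈ convexHull ℝ (Set.range vhat),
      ∀ u : EuclideanSpace ℝ (Fin (n + 1)), x + u ∈ P' → x - u ∈ P' → |u m| ≤ K' * x m := by
    intro m
    obtain ⟨l, K, hK, hl0, hlK, hlv⟩ := hexp m
    refine polytope_to_simplex hvhat m (l.comp B) hK ?_ ?_ ?_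
    · rw [hP']
      rintro _ ⟨p, hp, rfl⟩
      simpa [hBL] using hl0 p hp
    · rw [hP']
      rintro _ ⟨p, hp, rfl⟩
      simpa [hBL] using hlK p hp
    · intro k hk
      rw [← hL k]
      simpa [hBL] using hlv k hk
  choose K' hK'0 hK' using hPH
  set K : ℝ := 1 + ∑ m, K' m with hKdef
  have hKpos : 0 < K := by
    have : 0 ≤ ∑ m, K' m := Finset.sum_nonneg fun m _ => hK'0 m
    linarith
  have hvnn : ∀ x ∈ Sn, ∀ i, 0 ≤ x i := by
    intro x hx i
    rw [hSn] at hx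
    obtain ⟨w, hw0, hw1, rfl⟩ := exists_weights _ hx
    simp only [WithLp.ofLp_sum, Finset.sum_apply, PiLp.smul_apply, smul_eq_mul]
    refine Finset.sum_nonneg fun k _ => mul_nonneg (hw0 k) ?_
    rw [hvhat]
    split_ifs
    · positivity
    · exact le_rfl
  have hKle : ∀ x ∈ Sn, ∀ u : EuclideanSpace ℝ (Fin (n + 1)), x + u ∈ P' → x - u ∈ P' →
      ∀ m, |u m| ≤ K * x m := by
    intro x hx u h1 h2 m
    refine (hK' m x (hSn ▸ hx) u h1 h2).trans ?_
    refine mul_le_mul_of_nonneg_right ?_ (hvnn x hx m)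
    have := Finset.single_le_sum (f := K') (fun i _ => hK'0 i) (Finset.mem_univ m)
    linarith
  refine ⟨max 1 (max (4 / c) (4 / K⁻¹)), le_max_left _ _, ?_⟩
  rintro x ⟨hxS, hxP⟩ v hv
  have hx1 : ∑ i, x i = 1 := ((mem_ri_iff hspanP x).1 hxP).1
  have hxpos : ∀ i, 0 < x i := by
    intro i
    obtain ⟨-, δ, hδ, hball⟩ := (mem_ri_iff hspanP x).1 hxP
    obtain ⟨j, hj⟩ : ∃ j : Fin (n + 1), j ≠ i := by
      by_cases h0 : i = 0
      · refine ⟨Fin.last n, ?_⟩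
        rw [h0]
        intro h
        have := congrArg Fin.val h
        simp at this
        omega
      · exact ⟨0, Ne.symm h0⟩
    set d : EuclideanSpace ℝ (Fin (n + 1)) :=
      EuclideanSpace.single i (1 : ℝ) - EuclideanSpace.single j (1 : ℝ) with hd
    have hds : ∑ l, d l = 0 := by
      simp [hd, Finset.sum_sub_distrib, Pi.single_apply]
    have hdi : d i = 1 := by
      simp [hd, hj, Ne.symm hj]
    have hdn : 0 < ‖d‖ + 1 := by positivity
    set u := (δ / (‖d‖ + 1)) • d with hu
    have hun : ‖u‖ < δ := by
      rw [hu, norm_smul, Real.norm_of_nonneg (by positivity), div_mul_eq_mul_div, div_lt_iff₀ hdn]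
      nlinarith
    have hus : ∑ l, u l = 0 := by
      simp only [hu, PiLp.smul_apply, smul_eq_mul, ← Finset.mul_sum, hds, mul_zero]
    have h1 : x + u ∈ P' := by
      apply hball
      · simp only [PiLp.add_apply, Finset.sum_add_distrib, hx1, hus, add_zero]
      · rwa [dist_eq_norm, add_sub_cancel_left]
    have h2 : x - u ∈ P' := by
      apply hball
      · simp only [PiLp.sub_apply, Finset.sum_sub_distrib, hx1, hus, sub_zero]
      · rwa [dist_eq_norm, sub_sub_cancel_left, norm_neg]
    have h3 := hKle x hxS u h1 h2 i
    have h4 : u i = δ / (‖d‖ + 1) := by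
      simp only [hu, PiLp.smul_apply, smul_eq_mul, hdi, mul_one]
    rw [h4, abs_of_pos (by positivity)] at h3
    have h5 : 0 < δ / (‖d‖ + 1) := by positivity
    by_contra hneg
    push Not at hneg
    nlinarith
  have hxH : x ∈ intrinsicInterior ℝ Hn := by
    rw [mem_ri_iff hspanH]
    obtain ⟨δ, hδ, hδx⟩ := exists_uniform_pos (fun i => x i) hxpos
    refine ⟨hx1, δ, hδ, fun y hy hyd => (hHmem y).2 ⟨fun i => ?_, hy⟩⟩
    have h1 : |(y - x) i| ≤ ‖y - x‖ := by
      have := PiLp.norm_apply_le (y - x) i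
      rwa [Real.norm_eq_abs] at this
    rw [dist_eq_norm] at hyd
    have h2 := (abs_le.1 h1).1
    have h3 := hδx i
    simp only [PiLp.sub_apply] at h2
    linarith
  have a1 : finslerNorm (intrinsicInterior ℝ P') x v ≤
      4 / c * finslerNorm (intrinsicInterior ℝ Hn) x v := by
    refine finsler_le hHc hP'c hspanH hspanP hHb hP'b hv hxH hxP hc ?_
    intro u hu h1 h2
    have hle : ∀ i, |u i| ≤ x i := by
      intro i
      have e1 := ((hHmem _).1 h1).1 i
      have e2 := ((hHmem _).1 h2).1 i
      simp only [PiLp.add_apply, PiLp.sub_apply] at e1 e2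
      rw [abs_le]
      constructor <;> linarith
    refine ⟨hHP x (hSn ▸ hxS) u hu hle, ?_⟩
    have := hHP x (hSn ▸ hxS) (-u) (by simp [hu]) (by simpa using hle)
    rwa [smul_neg, ← sub_eq_add_neg] at this
  have a2 : finslerNorm (intrinsicInterior ℝ Hn) x v ≤
      4 / K⁻¹ * finslerNorm (intrinsicInterior ℝ P') x v := by
    refine finsler_le hP'c hHc hspanP hspanH hP'b hHb hv hxP hxH (inv_pos.2 hKpos) ?_
    intro u hu h1 h2
    have hle : ∀ i, |K⁻¹ * u i| ≤ x i := by
      intro i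
      rw [abs_mul, abs_of_pos (inv_pos.2 hKpos), inv_mul_le_iff₀ hKpos]
      exact hKle x hxS u h1 h2 i
    constructor
    · refine (hHmem _).2 ⟨fun i => ?_, ?_⟩
      · have := (abs_le.1 (hle i)).1
        simp only [PiLp.add_apply, PiLp.smul_apply, smul_eq_mul]
        linarith
      · simp only [PiLp.add_apply, PiLp.smul_apply, smul_eq_mul, Finset.sum_add_distrib,
          ← Finset.mul_sum, hx1, hu]
        ring
    · refine (hHmem _).2 ⟨fun i => ?_, ?_⟩
      · have := (abs_le.1 (hle i)).2
        simp only [PiLp.sub_apply, PiLp.smul_apply, smul_eq_mul]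
        linarith
      · simp only [PiLp.sub_apply, PiLp.smul_apply, smul_eq_mul, Finset.sum_sub_distrib,
          ← Finset.mul_sum, hx1, hu]
        ring
  have n1 : 0 ≤ finslerNorm (intrinsicInterior ℝ Hn) x v := by
    have h4 := finsler_le hHc hHc hspanH hspanH hHb hHb hv hxH hxH (c := 1) one_pos
      (fun u _ h1 h2 => by simpa using ⟨h1, h2⟩)
    linarith
  have n2 : 0 ≤ finslerNorm (intrinsicInterior ℝ P') x v := by
    have h4 := finsler_le hP'c hP'c hspanP hspanP hP'b hP'b hv hxP hxP (c := 1) one_pos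
      (fun u _ h1 h2 => by simpa using ⟨h1, h2⟩)
    linarith
  set k := max 1 (max (4 / c) (4 / K⁻¹)) with hk
  have hk0 : 0 < k := lt_of_lt_of_le one_pos (le_max_left _ _)
  have hk1 : 4 / c ≤ k := (le_max_left _ _).trans (le_max_right _ _)
  have hk2 : 4 / K⁻¹ ≤ k := (le_max_right _ _).trans (le_max_right _ _)
  constructor
  · rw [inv_mul_le_iff₀ hk0]
    exact a1.trans (mul_le_mul_of_nonneg_right hk1 n1)
  · exact a2.trans (mul_le_mul_of_nonneg_right hk2 n2)
end
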